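/- Let n ≥ 2. The set of chaotic automorphisms is comeagre in Aut_{ω₀}(ℂⁿ); that is, there is a subset of Aut_{ω₀}(ℂⁿ) containing a countable intersection of dense open subsets of Aut_{ω₀}(ℂⁿ), all of whose elements are chaotic. -/

import Mathlib

open Topology Filter Metric Set Function

noncomputable section

/-- ℂⁿ with the Euclidean norm. -/
abbrev En (n : ℕ) : Type := EuclideanSpace ℂ (Fin n)

/-- A holomorphic automorphism of ℂⁿ: a bijection that is holomorphic with holomorphic inverse. -/
def IsHoloAut {n : ℕ} (f : En n → En n) : Prop :=
  Differentiable ℂ f ∧ ∃ g : En n → En n, Differentiable ℂ g ∧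
    Function.LeftInverse g f ∧ Function.RightInverse g f

/-- Volume-preserving with respect to ω₀ = dz₁∧⋯∧dzₙ: det Df(z) = 1 for all z. -/
def IsVolPres {n : ℕ} (f : En n → En n) : Prop :=
  ∀ z : En n, (fderiv ℂ f z).det = 1

/-- Aut(ℂⁿ) as a subset of C(ℂⁿ, ℂⁿ) with the compact-open topology. -/
def AutCN (n : ℕ) : Set C(En n, En n) := {f | IsHoloAut ⇑f}

/-- Aut_{ω₀}(ℂⁿ) as a subset of C(ℂⁿ, ℂⁿ) with the compact-open topology. -/
def AutOmega (n : ℕ) : Set C(En n, En n) := {f | IsHoloAut ⇑f ∧ IsVolPres ⇑f}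

/-- A continuous self-map is chaotic if it has a dense forward orbit and its set of
periodic points is dense. -/
def Chaotic {α : Type*} [TopologicalSpace α] (f : α → α) : Prop :=
  (∃ x : α, Dense (Set.range fun k : ℕ => f^[k] x)) ∧
  Dense {x : α | ∃ k : ℕ, 0 < k ∧ f^[k] x = x}

/-- Expelling: the set of points with unbounded forward orbit is dense. -/
def Expelling {n : ℕ} (f : En n → En n) : Prop :=
  Dense {x : En n | ¬ Bornology.IsBounded (Set.range fun k : ℕ => f^[k] x)}

/-- p is a hyperbolic fixed point of f: f(p) = p and no eigenvalue of Df(p) has modulus 1. -/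
def HypFixedPt {n : ℕ} (f : En n → En n) (p : En n) : Prop :=
  f p = p ∧ ∀ μ : ℂ, Module.End.HasEigenvalue
    ((fderiv ℂ f p : En n →ₗ[ℂ] En n) : Module.End ℂ (En n)) μ → ‖μ‖ ≠ 1

/-- The stable manifold of a fixed point p of f: points whose forward orbit tends to p. -/
def StableSet {n : ℕ} (f : En n → En n) (p : En n) : Set (En n) :=
  {x : En n | Tendsto (fun k : ℕ => f^[k] x) atTop (𝓝 p)}

set_option linter.unusedSectionVars false
set_option linter.unusedVariables false
set_option linter.style.haveILetI false
set_option linter.unusedSimpArgs false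

section PA
variable {E F : Type} [NormedAddCommGroup E] [NormedSpace ℂ E] [NormedAddCommGroup F]
  [NormedSpace ℂ F]

lemma cauchy_fderiv {f : E → F} (hf : Differentiable ℂ f) {x : E} {r M : ℝ} (hr : 0 < r)
    (hM : ∀ z ∈ ball x r, ‖f z‖ ≤ M) : ‖fderiv ℂ f x‖ ≤ 2 * M / r := by
  apply Complex.norm_fderiv_le_div_of_mapsTo_ball hf.differentiableOn _ hr
  intro z hz
  rw [mem_closedBall, dist_eq_norm]
  have h1 := hM z hz
  have h2 := hM x (mem_ball_self hr)
  have := norm_sub_le (f z) (f x)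
  linarith

lemma cauchy_lip {f : E → F} (hf : Differentiable ℂ f) {x0 : E} {r M : ℝ} (hr : 0 < r)
    (hM : ∀ z ∈ ball x0 (2 * r), ‖f z‖ ≤ M) {x y : E} (hx : x ∈ ball x0 r) (hy : y ∈ ball x0 r) :
    ‖f y - f x‖ ≤ 2 * M / r * ‖y - x‖ := by
  let _ : NormedSpace ℝ E := NormedSpace.restrictScalars ℝ ℂ E
  apply Convex.norm_image_sub_le_of_norm_fderiv_le (𝕜 := ℂ) (s := ball x0 r)
    (fun z _ => hf z) _ (convex_ball x0 r) hx hy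
  intro z hz
  apply cauchy_fderiv hf hr
  intro w hw
  apply hM
  rw [mem_ball] at *
  have := dist_triangle w z x0
  linarith

lemma fderiv_lip {f : E → F} (hf : Differentiable ℂ f) {x0 : E} {r M : ℝ} (hr : 0 < r)
    (hM : ∀ z ∈ ball x0 (4 * r), ‖f z‖ ≤ M) {x y : E} (hx : x ∈ ball x0 r) (hy : y ∈ ball x0 r) :
    ‖fderiv ℂ f y - fderiv ℂ f x‖ ≤ 2 * M / r ^ 2 * ‖y - x‖ := by
  set g : E → F := fun z => f (z + (y - x)) - f z with hg
  have hgd : Differentiable ℂ g := by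
    intro z
    exact ((hf _).comp z ((differentiableAt_id).add_const _)).sub (hf z)
  have hd : fderiv ℂ g x = fderiv ℂ f y - fderiv ℂ f x := by
    rw [hg, fderiv_fun_sub _ (hf x)]
    · rw [fderiv_comp_add_right]; simp
    · exact (hf _).comp x ((differentiableAt_id).add_const _)
  rw [← hd]
  have : ∀ z ∈ ball x r, ‖g z‖ ≤ 2 * M / (2 * r) * ‖y - x‖ := by
    intro z hz
    have h1 : z ∈ ball x0 (2 * r) := by
      rw [mem_ball] at *
      have := dist_triangle z x x0
      linarith
    have h2 : z + (y - x) ∈ ball x0 (2 * r) := by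
      rw [mem_ball] at *
      have := dist_triangle (z + (y - x)) y x0
      have h3 : dist (z + (y - x)) y = dist z x := by
        rw [dist_eq_norm, dist_eq_norm]; congr 1; abel
      linarith
    have := cauchy_lip hf (x0 := x0) (r := 2 * r) (M := M) (by positivity)
      (by intro w hw; apply hM; convert hw using 2; ring) h1 h2
    convert this using 3
    abel
  have := cauchy_fderiv hgd hr this
  calc ‖fderiv ℂ g x‖ ≤ _ := this
    _ = _ := by field_simp

lemma taylor2 {f : E → F} (hf : Differentiable ℂ f) {x0 : E} {r M : ℝ} (hr : 0 < r)
    (hM : ∀ z ∈ ball x0 (4 * r), ‖f z‖ ≤ M) {x y : E} (hx : x ∈ ball x0 r) (hy : y ∈ ball x0 r) :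
    ‖f y - f x - fderiv ℂ f x (y - x)‖ ≤ 2 * M / r ^ 2 * ‖y - x‖ ^ 2 := by
  let _ : NormedSpace ℝ E := NormedSpace.restrictScalars ℝ ℂ E
  have hM0 : 0 ≤ M := (norm_nonneg _).trans (hM x0 (mem_ball_self (by positivity)))
  have := Convex.norm_image_sub_le_of_norm_fderiv_le' (𝕜 := ℂ) (s := segment ℝ x y) (f := f)
    (φ := fderiv ℂ f x) (C := 2 * M / r ^ 2 * ‖y - x‖) (x := x) (y := y)
    (fun z _ => hf z) ?_ (convex_segment x y) (left_mem_segment _ _ _) (right_mem_segment _ _ _)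
  · rw [pow_two ‖y - x‖, ← mul_assoc]; exact this
  · intro z hz
    have hz' : z ∈ ball x0 r := (convex_ball x0 r).segment_subset hx hy hz
    refine (fderiv_lip hf hr hM hx hz').trans ?_
    gcongr
    rw [segment_eq_image'] at hz
    obtain ⟨θ, hθ, rfl⟩ := hz
    simp only [add_sub_cancel_left]
    rw [norm_smul, Real.norm_eq_abs, abs_of_nonneg hθ.1]
    exact mul_le_of_le_one_left (norm_nonneg _) hθ.2

lemma exists_bdd_ball {f : E → F} (hf : Continuous f) (x0 : E) :
    ∃ r > 0, ∃ M, ∀ z ∈ ball x0 (4 * r), ‖f z‖ ≤ M := by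
  have : ∀ᶠ z in 𝓝 x0, ‖f z‖ < ‖f x0‖ + 1 := by
    apply (hf.norm.continuousAt).eventually_lt_const
    linarith
  obtain ⟨r, hr, h⟩ := Metric.eventually_nhds_iff_ball.1 this
  exact ⟨r / 4, by positivity, _, fun z hz => (h z (by convert hz using 2; ring)).le⟩

lemma continuous_fderiv_entire {f : E → F} (hf : Differentiable ℂ f) :
    Continuous (fderiv ℂ f) := by
  rw [continuous_iff_continuousAt]
  intro x0
  obtain ⟨r, hr, M, hM⟩ := exists_bdd_ball hf.continuous x0
  have : LipschitzOnWith (Real.toNNReal (2 * M / r ^ 2)) (fderiv ℂ f) (ball x0 r) := by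
    apply LipschitzOnWith.of_dist_le_mul
    intro x hx y hy
    rw [dist_eq_norm, dist_eq_norm]
    refine (fderiv_lip hf hr hM hy hx).trans ?_
    gcongr
    exact Real.le_coe_toNNReal _
  exact this.continuousOn.continuousAt (ball_mem_nhds _ hr)

lemma hasStrictFDerivAt_entire {f : E → F} (hf : Differentiable ℂ f) (x : E) :
    HasStrictFDerivAt f (fderiv ℂ f x) x :=
  hasStrictFDerivAt_of_hasFDerivAt_of_continuousAt
    (Eventually.of_forall fun y => (hf y).hasFDerivAt) (continuous_fderiv_entire hf).continuousAt

lemma differentiable_fderiv_apply [CompleteSpace F] {f : E → F} (hf : Differentiable ℂ f) (v : E) :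
    Differentiable ℂ (fun x => fderiv ℂ f x v) := by
  have key : ∀ x, fderiv ℂ f x v = (2 * Real.pi * Complex.I)⁻¹ •
      ∫ θ in (0:ℝ)..2 * Real.pi, (deriv (circleMap 0 1) θ * (1 / (circleMap 0 1 θ) ^ 2)) •
        f (x + circleMap 0 1 θ • v) := by
    intro x
    set g : ℂ → F := fun t => f (x + t • v)
    have hg : Differentiable ℂ g := fun t => (hf _).comp t (by fun_prop)
    have h1 : deriv g 0 = fderiv ℂ f x v := by
      have : HasDerivAt g (fderiv ℂ f (x + (0:ℂ) • v) ((1:ℂ) • v)) 0 := by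
        apply (hf _).hasFDerivAt.comp_hasDerivAt
        exact ((hasDerivAt_id (0:ℂ)).smul_const v).const_add x
      simpa using this.deriv
    have h2 := DiffContOnCl.deriv_eq_smul_circleIntegral (c := 0) (R := 1) (f := g) one_pos
      hg.diffContOnCl
    rw [h1] at h2
    rw [eq_inv_smul_iff₀ (by simp [Real.pi_ne_zero]), ← h2, circleIntegral]
    congr 1
    ext θ
    simp [g, mul_smul]
  have hE : (fun x => fderiv ℂ f x v) = _ := funext key
  rw [hE]
  apply Differentiable.const_smul
  intro x0
  set c : ℝ → ℂ := fun θ => deriv (circleMap 0 1) θ * (1 / (circleMap 0 1 θ) ^ 2) with hc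
  have hcn : ∀ θ, ‖c θ‖ = 1 := by intro θ; simp [hc]
  have hcc : Continuous c := by
    rw [hc]
    simp only [deriv_circleMap]
    refine (by fun_prop : Continuous _).mul (Continuous.div (by fun_prop) (by fun_prop) ?_)
    intro θ; simp
  have hcirc : Continuous (circleMap 0 1) := continuous_circleMap 0 1
  have hfc := continuous_fderiv_entire hf
  -- local bound
  have hb : ∃ C, ∀ᶠ x in 𝓝 x0, ∀ θ ∈ Icc (0:ℝ) (2 * Real.pi),
      ‖fderiv ℂ f (x + circleMap 0 1 θ • v)‖ ≤ C := by
    have hK : IsCompact ((fun θ => fderiv ℂ f (x0 + circleMap 0 1 θ • v)) '' Icc (0:ℝ) (2 * Real.pi)) :=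
      isCompact_Icc.image (by fun_prop)
    obtain ⟨C, hC⟩ := hK.isBounded.exists_norm_le
    refine ⟨C + 1, ?_⟩
    have := isCompact_Icc (a := (0:ℝ)) (b := 2 * Real.pi) |>.eventually_forall_of_forall_eventually
      (x₀ := x0) (P := fun x θ => ‖fderiv ℂ f (x + circleMap 0 1 θ • v)‖ ≤ C + 1) ?_
    · exact this
    · intro θ hθ
      have h0 := hC _ (mem_image_of_mem _ hθ)
      have hcont : Continuous (fun z : E × ℝ => ‖fderiv ℂ f (z.1 + circleMap 0 1 z.2 • v)‖) := by
        fun_prop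
      have := hcont.continuousAt (x := (x0, θ)) |>.eventually_lt_const (u := C + 1)
        (by show ‖fderiv ℂ f (x0 + circleMap 0 1 θ • v)‖ < C + 1; linarith)
      exact this.mono fun z hz => hz.le
  obtain ⟨C, hC⟩ := hb
  have := intervalIntegral.hasFDerivAt_integral_of_dominated_of_fderiv_le (𝕜 := ℂ)
    (μ := MeasureTheory.volume) (a := 0) (b := 2 * Real.pi) (x₀ := x0)
    (F := fun x θ => c θ • f (x + circleMap 0 1 θ • v))
    (F' := fun x θ => c θ • fderiv ℂ f (x + circleMap 0 1 θ • v))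
    (bound := fun _ => C) hC ?_ ?_ ?_ ?_ ?_ ?_
  · exact this.differentiableAt
  · refine Eventually.of_forall fun x => Continuous.aestronglyMeasurable ?_
    have := hf.continuous
    fun_prop
  · apply Continuous.intervalIntegrable
    have := hf.continuous
    fun_prop
  · apply Continuous.aestronglyMeasurable
    fun_prop
  · refine Eventually.of_forall fun θ hθ x hx => ?_
    rw [norm_smul, hcn, one_mul]
    apply hx
    rw [uIoc_of_le (by positivity)] at hθ
    exact ⟨hθ.1.le, hθ.2⟩
  · exact intervalIntegrable_const
  · refine Eventually.of_forall fun θ hθ x hx => ?_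
    apply HasFDerivAt.const_smul
    exact (hasFDerivAt_comp_add_right (f := f) _).2 (hf _).hasFDerivAt

lemma contDiff_nat_entire [CompleteSpace F] [FiniteDimensional ℂ E] (m : ℕ) {f : E → F}
    (hf : Differentiable ℂ f) : ContDiff ℂ m f := by
  induction m generalizing f with
  | zero => exact contDiff_zero.2 hf.continuous
  | succ m ih =>
    push_cast
    rw [contDiff_succ_iff_fderiv_apply]
    exact ⟨hf, by simp, fun y => ih (differentiable_fderiv_apply hf y)⟩

lemma contDiff_entire [CompleteSpace F] [FiniteDimensional ℂ E] {f : E → F}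
    (hf : Differentiable ℂ f) {m : ℕ∞} : ContDiff ℂ m f :=
  (contDiff_infty.2 fun k => contDiff_nat_entire k hf).of_le (by exact_mod_cast le_top)

lemma differentiable_fderiv_entire [CompleteSpace F] [FiniteDimensional ℂ E] {f : E → F}
    (hf : Differentiable ℂ f) : Differentiable ℂ (fderiv ℂ f) := by
  have h : ContDiff ℂ (1 + 1) f := contDiff_nat_entire 2 hf
  exact ((contDiff_succ_iff_fderiv.1 h).2.2).differentiable (by simp)

end PA

set_option linter.unusedSectionVars false
section PB

lemma co_nhds {E F : Type} [NormedAddCommGroup E] [ProperSpace E] [NormedAddCommGroup F]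
    {f : C(E, F)} {O : Set C(E, F)} (hO : O ∈ 𝓝 f) :
    ∃ R > 0, ∃ ε > 0, ∀ g : C(E, F), (∀ z, ‖z‖ ≤ R → ‖g z - f z‖ < ε) → g ∈ O := by
  rw [UniformSpace.mem_nhds_iff] at hO
  obtain ⟨V, hV, hVO⟩ := hO
  rw [ContinuousMap.mem_compactConvergence_entourage_iff] at hV
  obtain ⟨K, W, hK, hW, hKW⟩ := hV
  obtain ⟨ε, hε, hεW⟩ := Metric.mem_uniformity_dist.1 hW
  obtain ⟨R, hR⟩ := hK.isBounded.exists_norm_le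
  refine ⟨max R 1, by positivity, ε, hε, fun g hg => hVO ?_⟩
  apply hKW
  intro x hx
  apply hεW
  rw [dist_comm, dist_eq_norm]
  exact hg x ((hR x hx).trans (le_max_left _ _))

lemma co_mem_nhds {E F : Type} [NormedAddCommGroup E] [ProperSpace E] [NormedAddCommGroup F]
    (f : C(E, F)) (R : ℝ) {ε : ℝ} (hε : 0 < ε) :
    {g : C(E, F) | ∀ z, ‖z‖ ≤ R → ‖g z - f z‖ < ε} ∈ 𝓝 f := by
  rw [UniformSpace.mem_nhds_iff]
  refine ⟨{fg | ∀ x ∈ closedBall (0:E) R, (fg.1 x, fg.2 x) ∈ {p : F × F | dist p.1 p.2 < ε}}, ?_, ?_⟩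
  · rw [ContinuousMap.mem_compactConvergence_entourage_iff]
    exact ⟨_, _, isCompact_closedBall 0 R, Metric.dist_mem_uniformity hε, subset_rfl⟩
  · intro g hg z hz
    have := hg z (by simpa using hz)
    simp only [mem_ofPred_eq] at this
    rwa [dist_comm, dist_eq_norm] at this

variable {E : Type} [NormedAddCommGroup E] [NormedSpace ℂ E] [FiniteDimensional ℂ E]

def cexpC (a : E →L[ℂ] ℂ) : C(E, ℂ) := ⟨fun z => Complex.exp (a z), by fun_prop⟩

variable (E) in
def expAlg : Subalgebra ℂ C(E, ℂ) := Algebra.adjoin ℂ (range cexpC)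

lemma expAlg_span {p : C(E, ℂ)} (hp : p ∈ expAlg E) : p ∈ Submodule.span ℂ (range (cexpC (E := E))) := by
  have : Subalgebra.toSubmodule (expAlg E) = Submodule.span ℂ (range (cexpC (E := E))) := by
    apply Algebra.adjoin_eq_span_of_subset
    refine subset_trans ?_ Submodule.subset_span
    have : Submonoid.closure (range (cexpC (E := E))) ≤
      { carrier := range (cexpC (E := E)),
        one_mem' := ⟨0, by ext z; simp [cexpC]⟩,
        mul_mem' := by
          rintro _ _ ⟨a, rfl⟩ ⟨b, rfl⟩
          exact ⟨a + b, by ext z; simp [cexpC, Complex.exp_add]⟩ : Submonoid C(E, ℂ)} :=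
      Submonoid.closure_le.2 subset_rfl
    exact this
  rw [← this]; exact hp

lemma lin_mem_closure (a : E →L[ℂ] ℂ) : (a : C(E, ℂ)) ∈ (expAlg E).topologicalClosure := by
  have : ProperSpace E := FiniteDimensional.proper ℂ E
  rw [← SetLike.mem_coe, Subalgebra.topologicalClosure_coe, mem_closure_iff_nhds]
  intro O hO
  obtain ⟨R, hR, ε, hε, h⟩ := co_nhds hO
  set B := ‖a‖ * R + 1 with hB
  have hB0 : 0 < B := by positivity
  obtain ⟨s, hs0, hs1, hs2⟩ : ∃ s : ℝ, 0 < s ∧ s * B ≤ 1 ∧ s * B ^ 2 < ε := by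
    refine ⟨min (1 / B) (ε / (2 * B ^ 2)), by positivity, ?_, ?_⟩
    · calc _ ≤ 1 / B * B := by gcongr; exact min_le_left _ _
        _ = 1 := by field_simp
    · calc _ ≤ ε / (2 * B ^ 2) * B ^ 2 := by gcongr; exact min_le_right _ _
        _ = ε / 2 := by field_simp
        _ < ε := by linarith
  refine ⟨(s:ℂ)⁻¹ • (cexpC ((s:ℂ) • a) - 1), h _ ?_, ?_⟩
  · intro z hz
    have haz : ‖a z‖ ≤ B := by
      calc ‖a z‖ ≤ ‖a‖ * ‖z‖ := a.le_opNorm z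
        _ ≤ ‖a‖ * R := by gcongr
        _ ≤ B := by simp [hB]
    have hsz : ‖(s:ℂ) * a z‖ ≤ s * B := by
      rw [norm_mul, Complex.norm_real, Real.norm_of_nonneg hs0.le]; gcongr
    have h1 := Complex.norm_exp_sub_one_sub_id_le (x := (s:ℂ) * a z) (hsz.trans hs1)
    have hs' : (s:ℂ) ≠ 0 := by exact_mod_cast hs0.ne'
    have h2 : ((s:ℂ)⁻¹ • (cexpC ((s:ℂ) • a) - 1)) z - (a : C(E, ℂ)) z
        = (s:ℂ)⁻¹ * (Complex.exp ((s:ℂ) * a z) - 1 - (s:ℂ) * a z) := by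
      simp [cexpC]
      field_simp
    rw [h2, norm_mul, norm_inv, Complex.norm_real, Real.norm_of_nonneg hs0.le]
    calc s⁻¹ * ‖Complex.exp ((s:ℂ) * a z) - 1 - (s:ℂ) * a z‖ ≤ s⁻¹ * ‖(s:ℂ) * a z‖ ^ 2 := by gcongr
      _ ≤ s⁻¹ * (s * B) ^ 2 := by gcongr
      _ = s * B ^ 2 := by field_simp
      _ < ε := hs2
  · apply Subalgebra.smul_mem
    apply Subalgebra.sub_mem _ (Algebra.subset_adjoin (mem_range_self _)) (Subalgebra.one_mem _)

lemma multilin_mem_closure (m : ℕ) (M : ContinuousMultilinearMap ℂ (fun _ : Fin m => E) ℂ) 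
    (p : C(E, ℂ)) (hp : ∀ z, p z = M (fun _ => z)) : p ∈ (expAlg E).topologicalClosure := by
  classical
  let b := Module.finBasis ℂ E
  let c : Fin (Module.finrank ℂ E) → (E →L[ℂ] ℂ) := fun i => LinearMap.toContinuousLinearMap (b.coord i)
  have : p = ∑ r : Fin m → Fin (Module.finrank ℂ E), (M fun k => b (r k)) •
      ∏ k, ((c (r k) : E →L[ℂ] ℂ) : C(E, ℂ)) := by
    ext z
    rw [hp]
    have hz : z = ∑ i, c i z • b i := by
      conv_lhs => rw [← b.sum_repr z]
      simp [c]
    conv_lhs => rw [hz]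
    have h1 := M.toMultilinearMap.map_sum (g := fun (_ : Fin m) i => c i z • b i)
    rw [show M (fun _ => ∑ i, c i z • b i) = M.toMultilinearMap (fun _ => ∑ i, c i z • b i) from rfl]
    rw [h1]
    simp [ContinuousMap.coe_sum, ContinuousMap.coe_prod]
    apply Finset.sum_congr rfl
    intro r _
    rw [M.map_smul_univ]
    simp [mul_comm]
  rw [this]
  apply Subalgebra.sum_mem
  intro r _
  apply Subalgebra.smul_mem
  apply Subalgebra.prod_mem
  intro k _
  exact lin_mem_closure _

lemma entire_mem_closure (h : E → ℂ) (hh : Differentiable ℂ h) :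
    (⟨h, hh.continuous⟩ : C(E, ℂ)) ∈ (expAlg E).topologicalClosure := by
  have : ProperSpace E := FiniteDimensional.proper ℂ E
  have hcl := (expAlg E).isClosed_topologicalClosure
  rw [← SetLike.mem_coe, ← hcl.closure_eq, mem_closure_iff_nhds]
  intro O hO
  obtain ⟨R, hR, ε, hε, hRε⟩ := co_nhds hO
  obtain ⟨M, hM⟩ := (isCompact_closedBall (0:E) (2 * R)).exists_bound_of_continuousOn hh.continuous.continuousOn
  have hM0 : 0 ≤ M := (norm_nonneg _).trans (hM 0 (by simp; positivity))
  let T : ℕ → C(E, ℂ) := fun m => ⟨fun z => ((m.factorial : ℂ)⁻¹ • iteratedFDeriv ℂ m h 0) (fun _ => z), by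
    have := ((m.factorial : ℂ)⁻¹ • iteratedFDeriv ℂ m h 0).cont
    exact this.comp (continuous_pi fun _ => continuous_id)⟩
  have hT : ∀ m, T m ∈ (expAlg E).topologicalClosure := fun m =>
    multilin_mem_closure m ((m.factorial : ℂ)⁻¹ • iteratedFDeriv ℂ m h 0) (T m) (fun z => rfl)
  -- values
  have hg : ∀ z, Differentiable ℂ (fun t : ℂ => h (t • z)) := fun z t => (hh _).comp t (by fun_prop)
  have hval : ∀ m z, T m z = (m.factorial : ℂ)⁻¹ * iteratedDeriv m (fun t : ℂ => h (t • z)) 0 := by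
    intro m z
    have h1 : (fun t : ℂ => h (t • z)) = h ∘ (ContinuousLinearMap.toSpanSingleton ℂ z) := by
      ext t; simp
    rw [iteratedDeriv_eq_iteratedFDeriv, h1, ContinuousLinearMap.iteratedFDeriv_comp_right _
      (contDiff_nat_entire m hh) _ le_rfl]
    simp [T]
  have hbd : ∀ m z, ‖z‖ ≤ R → ‖T m z‖ ≤ M * (1/2) ^ m := by
    intro m z hz
    have := Complex.norm_iteratedDeriv_le_of_forall_mem_sphere_norm_le (c := 0) (R := 2) (C := M) m
      two_pos (hg z).diffContOnCl (by
        intro t ht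
        apply hM
        simp at ht ⊢
        rw [norm_smul, ht]; gcongr)
    rw [hval, norm_mul, norm_inv, Complex.norm_natCast]
    calc _ ≤ (m.factorial : ℝ)⁻¹ * (m.factorial * M / 2 ^ m) := by gcongr
      _ = _ := by
        have : (m.factorial : ℝ) ≠ 0 := by positivity
        rw [one_div, inv_pow]
        field_simp
  have hsum : ∀ z, HasSum (fun m => T m z) (h z) := by
    intro z
    have := Complex.hasSum_taylorSeries_of_entire (hg z) 0 1
    simp only [sub_zero, one_pow, one_smul] at this
    have h2 : (fun m => T m z) = (fun n : ℕ => (n.factorial : ℂ)⁻¹ • iteratedDeriv n (fun t : ℂ => h (t • z)) 0) := by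
      funext m
      rw [hval]; simp
    rw [h2]
    exact this
  obtain ⟨N, hN⟩ : ∃ N : ℕ, M * (1/2) ^ N * 2 < ε := by
    have : Tendsto (fun N : ℕ => M * (1/2:ℝ) ^ N * 2) atTop (𝓝 (M * 0 * 2)) := by
      apply Tendsto.mul_const
      apply Tendsto.const_mul
      exact tendsto_pow_atTop_nhds_zero_of_lt_one (by norm_num) (by norm_num)
    simp only [mul_zero, zero_mul] at this
    exact (this.eventually_lt_const hε).exists
  refine ⟨∑ m ∈ Finset.range N, T m, hRε _ ?_, Subalgebra.sum_mem _ fun m _ => hT m⟩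
  intro z hz
  have h1 : HasSum (fun m => T (m + N) z) (h z - ∑ m ∈ Finset.range N, T m z) :=
    (hasSum_nat_add_iff' N).2 (hsum z)
  have h2 : HasSum (fun m : ℕ => M * (1/2:ℝ) ^ N * (1/2) ^ m) (M * (1/2) ^ N * 2) :=
    hasSum_geometric_two.mul_left _
  have h3 : ‖h z - ∑ m ∈ Finset.range N, T m z‖ ≤ M * (1/2) ^ N * 2 := by
    rw [← h1.tsum_eq]
    apply tsum_of_norm_bounded h2
    intro m
    refine (hbd _ z hz).trans_eq ?_
    rw [pow_add]; ring
  rw [ContinuousMap.coe_sum, Finset.sum_apply, norm_sub_rev]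
  exact h3.trans_lt hN

lemma entire_approx (h : E → ℂ) (hh : Differentiable ℂ h) (R : ℝ) {η : ℝ} (hη : 0 < η) :
    ∃ c : (E →L[ℂ] ℂ) →₀ ℂ, ∀ z, ‖z‖ ≤ R → ‖h z - c.sum (fun a t => t * Complex.exp (a z))‖ < η := by
  have : ProperSpace E := FiniteDimensional.proper ℂ E
  have h1 := entire_mem_closure h hh
  rw [← SetLike.mem_coe, Subalgebra.topologicalClosure_coe, mem_closure_iff_nhds] at h1
  obtain ⟨p, hp1, hp2⟩ := h1 _ (co_mem_nhds _ R hη)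
  obtain ⟨c, hc⟩ := Finsupp.mem_span_range_iff_exists_finsupp.1 (expAlg_span hp2)
  refine ⟨c, fun z hz => ?_⟩
  have := hp1 z hz
  rw [norm_sub_rev] at this
  have h2 : p z = c.sum (fun a t => t * Complex.exp (a z)) := by
    rw [← hc]
    simp [Finsupp.sum, cexpC, ContinuousMap.coe_sum]
  rw [← h2]
  exact this

end PB

set_option linter.unusedSectionVars false
section PC
variable {E : Type} [NormedAddCommGroup E] [InnerProductSpace ℂ E] [FiniteDimensional ℂ E]

def expShear (a : E →L[ℂ] ℂ) (u : E) : E → E := fun z => Complex.exp (a z) • u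

variable (E) in
def shearSpan : Submodule ℂ (E → E) :=
  Submodule.span ℂ {X | ∃ a : E →L[ℂ] ℂ, ∃ u : E, a u = 0 ∧ X = expShear a u}

lemma vec_approx (X : E → E) (hX : Differentiable ℂ X) (R : ℝ) {η : ℝ} (hη : 0 < η) :
    ∃ (S : Finset (E →L[ℂ] ℂ)) (u : (E →L[ℂ] ℂ) → E), ∀ z, ‖z‖ ≤ R →
      ‖X z - ∑ a ∈ S, Complex.exp (a z) • u a‖ ≤ η := by
  classical
  let b := Module.finBasis ℂ E
  let d := Module.finrank ℂ E
  set B := ∑ i, ‖b i‖ + 1 with hB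
  have hB0 : 0 < B := by positivity
  have hc : ∀ i, ∃ c : (E →L[ℂ] ℂ) →₀ ℂ, ∀ z, ‖z‖ ≤ R →
      ‖b.coord i (X z) - c.sum (fun a t => t * Complex.exp (a z))‖ < η / B := by
    intro i
    refine entire_approx (fun z => b.coord i (X z)) ?_ R (by positivity)
    exact (LinearMap.toContinuousLinearMap (b.coord i)).differentiable.comp hX
  choose c hc using hc
  refine ⟨Finset.univ.biUnion fun i => (c i).support, fun a => ∑ i, c i a • b i, fun z hz => ?_⟩
  set S := Finset.univ.biUnion fun i => (c i).support
  have h1 : ∑ a ∈ S, Complex.exp (a z) • ∑ i, c i a • b i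
      = ∑ i, (c i).sum (fun a t => t * Complex.exp (a z)) • b i := by
    simp_rw [Finset.smul_sum]
    rw [Finset.sum_comm]
    refine Finset.sum_congr rfl fun i _ => ?_
    rw [Finsupp.sum_of_support_subset (s := S) _ (Finset.subset_biUnion_of_mem (fun i => (c i).support) (Finset.mem_univ i)) _ (by simp),
      Finset.sum_smul]
    refine Finset.sum_congr rfl fun a _ => ?_
    rw [smul_smul, mul_comm]
  have h2 : X z = ∑ i, b.coord i (X z) • b i := by
    conv_lhs => rw [← b.sum_repr (X z)]
    simp
  rw [h1]
  conv_lhs => rw [h2]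
  rw [← Finset.sum_sub_distrib]
  calc _ ≤ ∑ i, ‖b.coord i (X z) • b i - (c i).sum (fun a t => t * Complex.exp (a z)) • b i‖ :=
        norm_sum_le _ _
    _ ≤ ∑ i, (η / B) * ‖b i‖ := by
        gcongr with i
        rw [← sub_smul, norm_smul]
        gcongr
        exact (hc i z hz).le
    _ = η / B * ∑ i, ‖b i‖ := by rw [Finset.mul_sum]
    _ ≤ η / B * B := by gcongr; simp [hB]
    _ = η := by field_simp

def dvg (X : E → E) (z : E) : ℂ := LinearMap.trace ℂ E (fderiv ℂ X z : E →ₗ[ℂ] E)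

lemma trace_bound : ∃ C : ℝ, 0 < C ∧ ∀ A : E →L[ℂ] E, ‖LinearMap.trace ℂ E (A : E →ₗ[ℂ] E)‖ ≤ C * ‖A‖ := by
  let L : (E →L[ℂ] E) →ₗ[ℂ] ℂ := (LinearMap.trace ℂ E) ∘ₗ (ContinuousLinearMap.coeLM ℂ)
  let L' := LinearMap.toContinuousLinearMap L
  refine ⟨‖L'‖ + 1, by positivity, fun A => ?_⟩
  have := L'.le_opNorm A
  have h2 : L' A = LinearMap.trace ℂ E (A : E →ₗ[ℂ] E) := rfl
  rw [h2] at this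
  nlinarith [norm_nonneg A]

lemma exists_unit_generic [Nontrivial E] (S : Finset (E →L[ℂ] ℂ)) :
    ∃ w : E, ‖w‖ = 1 ∧ ∀ a ∈ S, a ≠ 0 → a w ≠ 0 := by
  classical
  obtain ⟨x0, hx0⟩ := exists_ne (0 : E)
  let ι := {a // a ∈ insert (innerSL ℂ x0) S ∧ a ≠ 0}
  have : Finite ι := Finite.of_injective (β := ↥(insert (innerSL ℂ x0) S))
    (fun i => ⟨i.1, i.2.1⟩) (fun i j h => by ext1; simpa using h)
  obtain ⟨v, hv⟩ := Module.Dual.exists_forall_ne_zero_of_forall_exists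
    (fun i : ι => ((i.1 : E →L[ℂ] ℂ) : E →ₗ[ℂ] ℂ)) (fun i => by
      by_contra! h
      exact i.2.2 (by ext z; exact h z))
  have hv0 : v ≠ 0 := by
    rintro rfl
    have h1 : innerSL ℂ x0 ≠ 0 := by
      intro h
      have := congrArg (fun f : E →L[ℂ] ℂ => f x0) h
      simp at this
      exact hx0 this
    have := hv ⟨innerSL ℂ x0, by simp, h1⟩
    simp at this
  refine ⟨((‖v‖ : ℂ)⁻¹) • v, ?_, fun a ha ha0 => ?_⟩
  · rw [norm_smul, norm_inv, Complex.norm_real, norm_norm, inv_mul_cancel₀ (norm_ne_zero_iff.2 hv0)]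
  · have := hv ⟨a, by simp [ha], ha0⟩
    rw [map_smul]
    simp at this ⊢
    exact ⟨hv0, this⟩

lemma hasFDerivAt_cexpL (a : E →L[ℂ] ℂ) (z : E) :
    HasFDerivAt (fun z => Complex.exp (a z)) (Complex.exp (a z) • a) z := by
  exact (a.hasFDerivAt (x := z)).cexp

lemma divfree_approx [Nontrivial E] (X : E → E) (hX : Differentiable ℂ X) (hdiv : ∀ z, dvg X z = 0)
    {R : ℝ} (hR : 0 < R) {η : ℝ} (hη : 0 < η) :
    ∃ P ∈ shearSpan E, ∀ z, ‖z‖ ≤ R → ‖X z - P z‖ ≤ η := by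
  obtain ⟨C, hC0, hC⟩ := trace_bound (E := E)
  set η' := η / (1 + C * 2 * R) with hη'
  have hη'0 : 0 < η' := by positivity
  obtain ⟨S, u, hSu⟩ := vec_approx X hX (3 * R + 1) hη'0
  obtain ⟨w, hw, hSw⟩ := exists_unit_generic S
  set P : E → E := fun z => ∑ a ∈ S, Complex.exp (a z) • u a with hP
  have hPd : ∀ z, HasFDerivAt P (∑ a ∈ S, (Complex.exp (a z) • a).smulRight (u a)) z := by
    intro z
    exact HasFDerivAt.fun_sum fun a _ => (hasFDerivAt_cexpL a z).smul_const (u a)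
  set Q : E → ℂ := fun z => ∑ a ∈ S, (a (u a) / a w) * Complex.exp (a z) with hQ
  have hQd : ∀ z, HasFDerivAt Q (∑ a ∈ S, (a (u a) / a w) • (Complex.exp (a z) • a)) z := by
    intro z
    exact HasFDerivAt.fun_sum fun a _ => (hasFDerivAt_cexpL a z).const_mul _
  have hQw : ∀ z, (∑ a ∈ S, (a (u a) / a w) • (Complex.exp (a z) • a)) w = dvg P z := by
    intro z
    rw [dvg, (hPd z).fderiv]
    rw [_root_.sum_apply]
    have : ((∑ a ∈ S, (Complex.exp (a z) • a).smulRight (u a) : E →L[ℂ] E) : E →ₗ[ℂ] E)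
        = ∑ a ∈ S, ((Complex.exp (a z) • a : E →L[ℂ] ℂ) : E →ₗ[ℂ] ℂ).smulRight (u a) := by
      ext; simp
    rw [this, map_sum]
    refine Finset.sum_congr rfl fun a ha => ?_
    rw [LinearMap.trace_smulRight]
    simp
    by_cases h : a = 0
    · simp [h]
    · have := hSw a ha h
      field_simp
  have hdP : ∀ z, ‖z‖ ≤ 3 * R → ‖dvg P z‖ ≤ C * (2 * η') := by
    intro z hz
    have hd : Differentiable ℂ (fun z => X z - P z) := fun z => (hX z).sub (hPd z).differentiableAt
    have h1 : ‖fderiv ℂ (fun z => X z - P z) z‖ ≤ 2 * η' / 1 := by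
      apply cauchy_fderiv hd one_pos
      intro y hy
      apply hSu
      rw [mem_ball, dist_eq_norm] at hy
      have := norm_le_norm_add_norm_sub' y z
      linarith
    have h2 : dvg P z = - LinearMap.trace ℂ E ((fderiv ℂ (fun z => X z - P z) z : E →L[ℂ] E) : E →ₗ[ℂ] E) := by
      rw [fderiv_fun_sub (hX z) (hPd z).differentiableAt]
      have := hdiv z
      rw [dvg] at this
      simp [dvg, this]
    rw [h2, norm_neg]
    refine (hC _).trans ?_
    gcongr
    simpa using h1
  set lam : E →L[ℂ] ℂ := innerSL ℂ w with hlam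
  have hlw : lam w = 1 := by simp [hlam, hw]
  have hlz : ∀ z, ‖lam z‖ ≤ ‖z‖ := by
    intro z
    have := norm_inner_le_norm (𝕜 := ℂ) w z
    rw [hw, one_mul] at this
    exact this
  set pi : E →L[ℂ] E := ContinuousLinearMap.id ℂ E - lam.smulRight w with hpi
  have hpz : ∀ z, pi z = z - lam z • w := by intro z; simp [hpi]
  refine ⟨(∑ a ∈ S, expShear a (u a - (a (u a) / a w) • w)) +
    ∑ a ∈ S, (a (u a) / a w) • expShear (a ∘L pi) w, ?_, ?_⟩
  · apply Submodule.add_mem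
    · refine Submodule.sum_mem _ fun a ha => Submodule.subset_span ⟨a, _, ?_, rfl⟩
      rw [map_sub, map_smul, smul_eq_mul]
      by_cases h : a = 0
      · simp [h]
      · have := hSw a ha h
        field_simp
        simp
    · refine Submodule.sum_mem _ fun a ha => Submodule.smul_mem _ _ (Submodule.subset_span ⟨_, _, ?_, rfl⟩)
      simp [hpz, hlw]
  · intro z hz
    have hval : ((∑ a ∈ S, expShear a (u a - (a (u a) / a w) • w)) +
      ∑ a ∈ S, (a (u a) / a w) • expShear (a ∘L pi) w) z = P z - (Q z - Q (pi z)) • w := by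
      simp only [Pi.add_apply, Finset.sum_apply, Pi.smul_apply, expShear, smul_sub, hP, hQ,
        Finset.sum_sub_distrib, sub_smul, Finset.sum_smul, ContinuousLinearMap.comp_apply, smul_smul]
      simp_rw [mul_comm (Complex.exp (_))]
      abel
    rw [hval]
    have hQQ : ‖Q z - Q (pi z)‖ ≤ C * (2 * η') * R := by
      set g : ℂ → ℂ := fun s => Q (pi z + s • w)
      have hg : ∀ s, HasDerivAt g (dvg P (pi z + s • w)) s := by
        intro s
        have := (hQd (pi z + s • w)).comp_hasDerivAt s
          (((hasDerivAt_id s).smul_const w).const_add (pi z))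
        rw [← hQw]
        rw [one_smul] at this
        exact this
      have h1 : g (lam z) = Q z := by simp [g, hpz]
      have h0 : g 0 = Q (pi z) := by simp [g]
      rw [← h1, ← h0]
      have := Convex.norm_image_sub_le_of_norm_hasDerivWithin_le (𝕜 := ℂ) (s := closedBall (0:ℂ) R)
        (f := g) (C := C * (2 * η')) (x := 0) (y := lam z)
        (fun s _ => (hg s).hasDerivWithinAt) ?_ (convex_closedBall 0 R) (by simp [hR.le])
        (by simpa using (hlz z).trans hz)
      · refine this.trans ?_
        gcongr
        simpa using (hlz z).trans hz
      · intro s hs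
        apply hdP
        simp at hs
        calc ‖pi z + s • w‖ ≤ ‖pi z‖ + ‖s • w‖ := norm_add_le _ _
          _ ≤ (‖z‖ + ‖lam z • w‖) + ‖s • w‖ := by rw [hpz]; gcongr; exact norm_sub_le _ _
          _ ≤ 3 * R := by
            rw [norm_smul, norm_smul, hw]
            have := hlz z
            linarith
    calc ‖X z - (P z - (Q z - Q (pi z)) • w)‖ = ‖(X z - P z) + (Q z - Q (pi z)) • w‖ := by congr 1; abel
      _ ≤ ‖X z - P z‖ + ‖(Q z - Q (pi z)) • w‖ := norm_add_le _ _
      _ ≤ η' + C * (2 * η') * R := by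
        rw [norm_smul, hw, mul_one]
        gcongr
        exact hSu z (by linarith)
      _ = η := by rw [hη']; field_simp
end PC

set_option linter.unusedSectionVars false
section PD
variable {n : ℕ}

abbrev Mn (n : ℕ) := Fin n → Fin n → ℂ

def altDet (n : ℕ) : (Fin n → ℂ) [⋀^Fin n]→ₗ[ℂ] ℂ := Matrix.detRowAlternating

def cDet (n : ℕ) : ContinuousMultilinearMap ℂ (fun _ : Fin n => Fin n → ℂ) ℂ :=
  ⟨(altDet n).toMultilinearMap, by
    show Continuous fun M : Mn n => Matrix.det (Matrix.of M)
    exact Continuous.matrix_det (by fun_prop)⟩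

lemma cDet_eq (M : Mn n) : cDet n M = altDet n M := rfl

abbrev ev (l : Fin n) : En n := EuclideanSpace.single l 1

def matOf (A : En n →L[ℂ] En n) : Mn n := fun k l => A (ev l) k

def rowsW (k l : Fin n) (M : Mn n) : Mn n := fun i =>
  if i < k then M i else if i = k then Pi.single l 1 else Pi.single i 1

def stair (k : ℕ) (M : Mn n) : Mn n := fun i => if (i : ℕ) < k then M i else Pi.single i 1

lemma pi_sum_single (c : Fin n → ℂ) : c = ∑ l, c l • (Pi.single l (1:ℂ) : Fin n → ℂ) := by
  ext m; simp [Pi.single_apply]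

lemma sum_rowsW (k : Fin n) (M : Mn n) (c : Fin n → ℂ) :
    ∑ l, c l * cDet n (rowsW k l M) = altDet n (update (stair k M) k c) := by
  conv_rhs => rw [pi_sum_single c]
  rw [AlternatingMap.map_update_sum]
  refine Finset.sum_congr rfl fun l _ => ?_
  rw [AlternatingMap.map_update_smul, smul_eq_mul, cDet_eq]
  congr 2
  ext1 i
  by_cases h : i = k
  · subst h; simp [rowsW]
  · rw [update_of_ne h]
    simp [rowsW, stair, h]

lemma stair_zero (M : Mn n) : altDet n (stair 0 M) = 1 := by
  have : stair 0 M = (1 : Matrix (Fin n) (Fin n) ℂ) := by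
    ext i j; simp [stair, Matrix.one_apply, Pi.single_apply, eq_comm]
  rw [this]
  exact Matrix.det_one

lemma stair_last (M : Mn n) : stair n M = M := by
  ext i j; simp [stair]

lemma telescope (M : Mn n) (hM : altDet n M = 1) :
    ∑ k : Fin n, ∑ l, (M k l - (Pi.single k (1:ℂ) : Fin n → ℂ) l) * cDet n (rowsW k l M) = 0 := by
  have : ∀ k : Fin n, ∑ l, (M k l - (Pi.single k (1:ℂ) : Fin n → ℂ) l) * cDet n (rowsW k l M)
      = altDet n (stair (k + 1) M) - altDet n (stair k M) := by
    intro k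
    have h := sum_rowsW k M (M k - Pi.single k 1)
    simp only [Pi.sub_apply] at h
    rw [h, AlternatingMap.map_update_sub]
    congr 2
    · ext1 i
      by_cases h : i = k
      · subst h; simp [stair]
      · rw [update_of_ne h]
        have h' : (i:ℕ) ≠ k := fun h2 => h (Fin.ext h2)
        simp only [stair]
        congr 1
        simp; omega
    · ext1 i
      by_cases h : i = k
      · subst h; simp [stair]
      · rw [update_of_ne h]
  simp_rw [this]
  rw [Fin.sum_univ_eq_sum_range (fun k => altDet n (stair (k + 1) M) - altDet n (stair k M)),
    Finset.sum_range_sub (fun k => altDet n (stair k M)), stair_zero, stair_last, hM, sub_self]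

lemma antisym_sum (k i : Fin n) (hik : i < k) (M : Mn n) (h : Fin n → Fin n → ℂ)
    (hs : ∀ l m, h l m = h m l) :
    ∑ l, cDet n (update (rowsW k l M) i (h l)) = 0 := by
  set T : Fin n → Fin n → ℂ := fun l m => altDet n (update (rowsW k l M) i (Pi.single m 1))
  have h1 : ∀ l, cDet n (update (rowsW k l M) i (h l)) = ∑ m, h l m * T l m := by
    intro l
    rw [cDet_eq]
    conv_lhs => rw [pi_sum_single (h l)]
    rw [AlternatingMap.map_update_sum]
    refine Finset.sum_congr rfl fun m _ => ?_
    rw [AlternatingMap.map_update_smul, smul_eq_mul]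
  have h2 : ∀ l m, T m l = - T l m := by
    intro l m
    have := (altDet n).map_swap (update (rowsW k l M) i (Pi.single m 1)) hik.ne
    rw [← this]
    show altDet n _ = altDet n _
    congr 1
    ext1 j
    simp only [comp_apply]
    by_cases hj : j = i
    · subst hj
      rw [Equiv.swap_apply_left, update_self, update_of_ne hik.ne']
      simp [rowsW]
    · by_cases hj2 : j = k
      · subst hj2
        rw [Equiv.swap_apply_right, update_self, update_of_ne hik.ne']
        simp [rowsW]
      · rw [Equiv.swap_apply_of_ne_of_ne hj hj2, update_of_ne hj, update_of_ne hj]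
        simp [rowsW, hj2]
  simp_rw [h1]
  have h3 : ∑ l, ∑ m, h l m * T l m = - ∑ l, ∑ m, h l m * T l m := by
    conv_lhs => rw [Finset.sum_comm]
    rw [← Finset.sum_neg_distrib]
    refine Finset.sum_congr rfl fun l _ => ?_
    rw [← Finset.sum_neg_distrib]
    refine Finset.sum_congr rfl fun m _ => ?_
    rw [hs m l, h2 l m]; ring
  exact self_eq_neg.1 h3

def piolaC (k l : Fin n) (A : En n →L[ℂ] En n) : ℂ := cDet n (rowsW k l (matOf A))

def Psi (A : En n →L[ℂ] En n) : En n →L[ℂ] En n :=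
  ∑ k, ∑ l, (piolaC k l A • (EuclideanSpace.proj k : En n →L[ℂ] ℂ)).smulRight (ev l)

lemma differentiable_rowsW_matOf (k l : Fin n) :
    Differentiable ℂ (fun A : En n →L[ℂ] En n => rowsW k l (matOf A)) := by
  rw [differentiable_pi]
  intro i
  by_cases h : i < k
  · simp only [rowsW, h, if_true]
    rw [differentiable_pi]
    intro m
    simp only [matOf]
    fun_prop
  · simp only [rowsW, h, if_false]
    fun_prop

lemma piolaC_diff (k l : Fin n) : Differentiable ℂ (piolaC k l) := by
  intro A
  exact ((cDet n).hasFDerivAt (x := rowsW k l (matOf A))).differentiableAt.comp A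
    (differentiable_rowsW_matOf k l A)

lemma Psi_cont : Continuous (Psi (n := n)) := by
  unfold Psi
  have := fun k l : Fin n => (piolaC_diff k l).continuous
  refine continuous_finsetSum _ fun k _ => continuous_finsetSum _ fun l _ => ?_
  have h : Continuous fun A : En n →L[ℂ] En n => piolaC k l A • ((EuclideanSpace.proj k : En n →L[ℂ] ℂ).smulRight (ev l)) :=
    (this k l).smul continuous_const
  convert h using 2
  ext; simp

lemma piolaC_id (k l : Fin n) : piolaC k l (ContinuousLinearMap.id ℂ (En n)) = if k = l then 1 else 0 := by
  rw [piolaC, cDet_eq]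
  have hid : matOf (ContinuousLinearMap.id ℂ (En n)) = fun i => Pi.single i 1 := by
    ext i j; simp [matOf, Pi.single_apply, eq_comm]
  split_ifs with h
  · subst h
    have : rowsW k k (matOf (ContinuousLinearMap.id ℂ (En n))) = stair 0 (fun _ _ => 0) := by
      ext1 i
      simp only [rowsW, hid, stair]
      split_ifs with h1 h2 <;> simp_all
    rw [this, stair_zero]
  · apply AlternatingMap.map_eq_zero_of_eq (i := k) (j := l) _ _ _ h
    simp [rowsW, hid, Ne.symm h]

lemma Psi_id : Psi (ContinuousLinearMap.id ℂ (En n)) = ContinuousLinearMap.id ℂ (En n) := by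
  ext z i
  have : ∀ k l : Fin n, (piolaC k l (ContinuousLinearMap.id ℂ (En n)) • (EuclideanSpace.proj k : En n →L[ℂ] ℂ)).smulRight (ev l : En n) z
      = if k = l then z k • (ev l : En n) else 0 := by
    intro k l
    rw [piolaC_id]
    split_ifs <;> simp
  simp only [Psi, _root_.sum_apply, this]
  simp [Pi.single_apply]

def piolaX (F : En n → En n) : En n → En n := fun z => Psi (fderiv ℂ F z) (F z - z)

lemma piola (F : En n → En n) (hF : Differentiable ℂ F) (hdet : ∀ z, (fderiv ℂ F z).det = 1) :
    Differentiable ℂ (piolaX F) ∧ ∀ z, dvg (piolaX F) z = 0 := by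
  have hF2 := differentiable_fderiv_entire hF
  have hX : piolaX F = fun z => ∑ k, ∑ l, (piolaC k l (fderiv ℂ F z) * (F z - z) k) • (ev l : En n) := by
    funext z; simp [piolaX, Psi]
  -- derivative of coefficient
  set H : En n → En n →L[ℂ] (En n →L[ℂ] En n) := fun z => fderiv ℂ (fderiv ℂ F) z
  have hc : ∀ k l z, DifferentiableAt ℂ (fun z => piolaC k l (fderiv ℂ F z)) z :=
    fun k l z => (piolaC_diff k l _).comp z (hF2 z)
  have hE : ∀ k z, HasFDerivAt (fun z => (F z - z) k)
      ((EuclideanSpace.proj k : En n →L[ℂ] ℂ) ∘L (fderiv ℂ F z - ContinuousLinearMap.id ℂ _)) z := by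
    intro k z
    exact (EuclideanSpace.proj k : En n →L[ℂ] ℂ).hasFDerivAt.comp z ((hF z).hasFDerivAt.sub (hasFDerivAt_id z))
  have hXd : ∀ z, HasFDerivAt (piolaX F) (∑ k, ∑ l,
      (piolaC k l (fderiv ℂ F z) • ((EuclideanSpace.proj k : En n →L[ℂ] ℂ) ∘L (fderiv ℂ F z - ContinuousLinearMap.id ℂ _)) +
        (F z - z) k • fderiv ℂ (fun z => piolaC k l (fderiv ℂ F z)) z).smulRight (ev l : En n)) z := by
    intro z
    rw [hX]
    refine HasFDerivAt.fun_sum fun k _ => HasFDerivAt.fun_sum fun l _ => ?_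
    exact ((hc k l z).hasFDerivAt.mul (hE k z)).smul_const _
  refine ⟨fun z => (hXd z).differentiableAt, fun z => ?_⟩
  rw [dvg, (hXd z).fderiv]
  have htr : ∀ φ : Fin n → Fin n → (En n →L[ℂ] ℂ), LinearMap.trace ℂ (En n)
      ((∑ k, ∑ l, (φ k l).smulRight (ev l : En n) : En n →L[ℂ] En n) : En n →ₗ[ℂ] En n)
        = ∑ k, ∑ l, φ k l (ev l) := by
    intro φ
    have : ((∑ k, ∑ l, (φ k l).smulRight (ev l : En n) : En n →L[ℂ] En n) : En n →ₗ[ℂ] En n)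
      = ∑ k, ∑ l, ((φ k l : En n →L[ℂ] ℂ) : En n →ₗ[ℂ] ℂ).smulRight (ev l : En n) := by
      apply LinearMap.ext; intro v; simp
    rw [this]
    simp only [map_sum, LinearMap.trace_smulRight]
    simp
  rw [htr]
  simp only [_root_.add_apply, _root_.smul_apply, Finset.sum_add_distrib]
  have e1 : ∑ k : Fin n, ∑ l : Fin n, piolaC k l (fderiv ℂ F z) •
      ((EuclideanSpace.proj k : En n →L[ℂ] ℂ) ∘L (fderiv ℂ F z - ContinuousLinearMap.id ℂ _)) (ev l) = 0 := by
    have hM : altDet n (matOf (fderiv ℂ F z)) = 1 := by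
      rw [← hdet z, ContinuousLinearMap.det, ← LinearMap.det_toMatrix (EuclideanSpace.basisFun (Fin n) ℂ).toBasis]
      show Matrix.det _ = _
      congr 1
    rw [← telescope _ hM]
    refine Finset.sum_congr rfl fun k _ => Finset.sum_congr rfl fun l _ => ?_
    simp [piolaC, matOf, mul_comm, Pi.single_apply, eq_comm]
  have e2 : ∀ k : Fin n, ∑ l : Fin n, fderiv ℂ (fun z => piolaC k l (fderiv ℂ F z)) z (ev l) = 0 := by
    intro k
    have hder : ∀ l v, fderiv ℂ (fun z => piolaC k l (fderiv ℂ F z)) z v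
        = ∑ i, if i < k then cDet n (update (rowsW k l (matOf (fderiv ℂ F z))) i (fun m => H z v (ev m) i)) else 0 := by
      intro l v
      have hW : HasFDerivAt (fun z => rowsW k l (matOf (fderiv ℂ F z)))
          (ContinuousLinearMap.pi fun i => if i < k then ContinuousLinearMap.pi fun m =>
            (EuclideanSpace.proj i : En n →L[ℂ] ℂ) ∘L ((ContinuousLinearMap.apply ℂ (En n) (ev m : En n)) ∘L H z) else 0) z := by
        rw [hasFDerivAt_pi]
        intro i
        by_cases h : i < k
        · simp only [rowsW, h, if_true]
          rw [hasFDerivAt_pi]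
          intro m
          have h1 : HasFDerivAt (fun z => fderiv ℂ F z) (H z) z := (hF2 z).hasFDerivAt
          exact ((EuclideanSpace.proj i : En n →L[ℂ] ℂ) ∘L (ContinuousLinearMap.apply ℂ (En n) (ev m : En n))).hasFDerivAt.comp z h1
        · simp only [rowsW, h, if_false]
          exact hasFDerivAt_const _ _
      have := ((cDet n).hasFDerivAt (x := rowsW k l (matOf (fderiv ℂ F z)))).comp z hW
      have h3 : fderiv ℂ (fun z => piolaC k l (fderiv ℂ F z)) z = _ := this.fderiv
      rw [h3]
      simp only [ContinuousLinearMap.comp_apply, ContinuousMultilinearMap.linearDeriv_apply]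
      refine Finset.sum_congr rfl fun i _ => ?_
      by_cases h : i < k
      · simp [h]
      · simp only [h, if_false]
        apply (cDet n).map_coord_zero i
        simp [h]
    simp_rw [hder]
    rw [Finset.sum_comm]
    refine Finset.sum_eq_zero fun i _ => ?_
    by_cases h : i < k
    · simp only [h, if_true]
      apply antisym_sum k i h
      intro l m
      have hs : IsSymmSndFDerivAt ℂ F z := by
        apply ContDiffAt.isSymmSndFDerivAt (n := 2) (contDiff_nat_entire 2 hF).contDiffAt
        simp
      exact congrArg (fun w : En n => w i) (hs (ev l) (ev m))
    · simp [h]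
  rw [e1, zero_add]
  refine Finset.sum_eq_zero fun k _ => ?_
  rw [← Finset.smul_sum, e2, smul_zero]
end PD

set_option linter.unusedSectionVars false
section PE
variable {n : ℕ}

lemma inv_props (A : En n →L[ℂ] En n) (h : A.det = 1) :
    (∀ v, A.inverse (A v) = v) ∧ (∀ v, A (A.inverse v) = v) := by
  have h0 : A.det ≠ 0 := by rw [h]; exact one_ne_zero
  have e := ContinuousLinearMap.coe_toContinuousLinearEquivOfDetNeZero A h0
  have e2 : A.inverse = ((A.toContinuousLinearEquivOfDetNeZero h0).symm : En n →L[ℂ] En n) := by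
    conv_lhs => rw [← e]
    exact ContinuousLinearMap.inverse_equiv _
  rw [e2]
  constructor
  · intro v
    exact (A.toContinuousLinearEquivOfDetNeZero h0).symm_apply_apply v
  · intro v
    exact (A.toContinuousLinearEquivOfDetNeZero h0).apply_symm_apply v

lemma inv_bound (C1 : ℝ) : ∃ C3 : ℝ, ∀ A : En n →L[ℂ] En n, A.det = 1 → ‖A‖ ≤ C1 →
    ∀ v, ‖v‖ ≤ C3 * ‖A v‖ := by
  have hK : IsCompact (closedBall (0 : En n →L[ℂ] En n) C1 ∩ {A | A.det = 1}) := by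
    apply (isCompact_closedBall _ _).inter_right
    exact isClosed_eq ContinuousLinearMap.continuous_det continuous_const
  have hc : ContinuousOn (fun A : En n →L[ℂ] En n => A.inverse)
      (closedBall (0 : En n →L[ℂ] En n) C1 ∩ {A | A.det = 1}) := by
    intro A hA
    have h0 : A.det ≠ 0 := by
      have : A.det = 1 := hA.2
      rw [this]; exact one_ne_zero
    have := (contDiffAt_map_inverse (𝕜 := ℂ) (n := 0)
      (A.toContinuousLinearEquivOfDetNeZero h0)).continuousAt
    rw [ContinuousLinearMap.coe_toContinuousLinearEquivOfDetNeZero] at this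
    exact this.continuousWithinAt
  obtain ⟨C, hC⟩ := hK.exists_bound_of_continuousOn hc
  refine ⟨C, fun A hA hn v => ?_⟩
  have h1 := hC A ⟨by simpa using hn, hA⟩
  calc ‖v‖ = ‖A.inverse (A v)‖ := by rw [(inv_props A hA).1]
    _ ≤ ‖A.inverse‖ * ‖A v‖ := A.inverse.le_opNorm _
    _ ≤ _ := by gcongr

lemma differentiable_iter {f : En n → En n} (hf : Differentiable ℂ f) (l : ℕ) :
    Differentiable ℂ (f^[l]) := by
  induction l with
  | zero => exact differentiable_id
  | succ l ih => rw [iterate_succ']; exact hf.comp ih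

lemma fderiv_iter_add {f : En n → En n} (hf : Differentiable ℂ f) (i j : ℕ) (x : En n) :
    fderiv ℂ (f^[i+j]) x = (fderiv ℂ (f^[i]) (f^[j] x)) ∘L (fderiv ℂ (f^[j]) x) := by
  rw [iterate_add]
  exact fderiv_comp x (differentiable_iter hf i _) (differentiable_iter hf j _)

lemma det_comp' (A B : En n →L[ℂ] En n) : (A ∘L B).det = A.det * B.det := by
  simp only [ContinuousLinearMap.det, ContinuousLinearMap.toLinearMap_comp]
  exact LinearMap.det_comp _ _

lemma det_iter {f : En n → En n} (hf : Differentiable ℂ f) (hd : ∀ z, (fderiv ℂ f z).det = 1)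
    (l : ℕ) (x : En n) : (fderiv ℂ (f^[l]) x).det = 1 := by
  induction l with
  | zero => 
    rw [iterate_zero, fderiv_id]
    simp [ContinuousLinearMap.det]
  | succ l ih =>
    rw [add_comm, fderiv_iter_add hf, det_comp', ih, iterate_one, hd, one_mul]

lemma core_bounds {γ : En n → En n} (hγ : Differentiable ℂ γ) (hd : ∀ z, (fderiv ℂ γ z).det = 1)
    {U : Set (En n)} (hU : IsOpen U) {R : ℝ} (hb : ∀ j, ∀ x ∈ U, ‖γ^[j] x‖ ≤ R)
    {x0 : En n} (hx0 : x0 ∈ U) : ∃ ρ > 0, ∃ K ≥ 1, ball x0 ρ ⊆ U ∧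
      ∀ l, ∀ x ∈ ball x0 ρ, ‖fderiv ℂ (γ^[l]) x‖ ≤ K ∧ (∀ v, ‖v‖ ≤ K * ‖fderiv ℂ (γ^[l]) x v‖) ∧
      ∀ y ∈ ball x0 ρ, ‖fderiv ℂ (γ^[l]) y - fderiv ℂ (γ^[l]) x‖ ≤ K * ‖y - x‖ ∧
       ‖γ^[l] y - γ^[l] x - fderiv ℂ (γ^[l]) x (y - x)‖ ≤ K * ‖y - x‖^2 := by
  obtain ⟨s, hs, hsU⟩ := Metric.isOpen_iff.1 hU x0 hx0
  set ρ := s / 4 with hρ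
  have hρ0 : 0 < ρ := by positivity
  obtain ⟨C3, hC3⟩ := inv_bound (n := n) (2 * R / ρ)
  have h4 : ∀ l, ∀ z ∈ ball x0 (4 * ρ), ‖γ^[l] z‖ ≤ R := by
    intro l z hz
    apply hb l z (hsU _)
    rwa [hρ, mul_div_cancel₀ _ (by norm_num)] at hz
  refine ⟨ρ, hρ0, max 1 (max (2 * R / ρ) (max C3 (2 * R / ρ^2))), le_max_left _ _, ?_, ?_⟩
  · exact (ball_subset_ball (by rw [hρ]; linarith)).trans hsU
  · intro l x hx
    have hD := differentiable_iter hγ l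
    have h1 : ‖fderiv ℂ (γ^[l]) x‖ ≤ 2 * R / ρ := by
      apply cauchy_fderiv hD hρ0
      intro z hz
      apply h4 l z
      rw [mem_ball] at *
      linarith [dist_triangle z x x0]
    refine ⟨h1.trans (by simp), fun v => ?_, fun y hy => ⟨?_, ?_⟩⟩
    · refine (hC3 _ (det_iter hγ hd l x) h1 v).trans ?_
      gcongr; simp
    · refine (fderiv_lip hD hρ0 (h4 l) hx hy).trans ?_
      gcongr; simp
    · refine (taylor2 hD hρ0 (h4 l) hx hy).trans ?_
      gcongr; simp

lemma quant_surj {G : En n → En n} (hG : Differentiable ℂ G) {A : En n →L[ℂ] En n} {K : ℝ}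
    (hK : 0 < K) (hA : ∀ v, ‖v‖ ≤ K * ‖A v‖) {x0 : En n} {r : ℝ} (hr : 0 ≤ r)
    (hG' : ∀ x ∈ closedBall x0 r, ‖fderiv ℂ G x - A‖ ≤ 1 / (2 * K)) {y : En n}
    (hy : ‖y - G x0‖ ≤ r / (2 * K)) : ∃ x, ‖x - x0‖ ≤ r ∧ G x = y := by
  have hinj : Injective A := by
    rw [injective_iff_map_eq_zero]
    intro v hv
    have := hA v
    rw [hv, norm_zero, mul_zero] at this
    exact norm_le_zero_iff.1 this
  have hsurj : Surjective A := (LinearMap.injective_iff_surjective (f := (A : En n →ₗ[ℂ] En n))).1 hinj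
  let f' : A.NonlinearRightInverse :=
    { toFun := fun v => surjInv hsurj v
      nnnorm := ⟨K, hK.le⟩
      bound' := fun v => by
        have := hA (surjInv hsurj v)
        rwa [surjInv_eq hsurj] at this
      right_inv' := fun v => surjInv_eq hsurj v }
  have ha : ApproximatesLinearOn G A (closedBall x0 r) ⟨1 / (2 * K), by positivity⟩ := by
    intro x hx z hz
    exact (convex_closedBall x0 r).norm_image_sub_le_of_norm_fderiv_le' (𝕜 := ℂ)
      (fun w _ => hG w) hG' hz hx
  have := ha.surjOn_closedBall_of_nonlinearRightInverse f' hr (b := x0) subset_rfl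
  have hm : y ∈ closedBall (G x0) ((((f'.nnnorm : NNReal) : ℝ)⁻¹ - ((⟨1 / (2 * K), by positivity⟩ : NNReal) : ℝ)) * r) := by
    rw [mem_closedBall, dist_eq_norm]
    refine hy.trans (le_of_eq ?_)
    change r / (2*K) = (K⁻¹ - 1/(2*K)) * r
    field_simp
    ring
  obtain ⟨x, hx, hxy⟩ := this hm
  exact ⟨x, by rwa [mem_closedBall, dist_eq_norm] at hx, hxy⟩
end PE

set_option linter.unusedSectionVars false
section PF
variable {n : ℕ}

def sN (γ : En n → En n) (x0 : En n) (X : En n → En n) (N : ℕ) : En n :=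
  ∑ l ∈ Finset.range N, (fderiv ℂ (γ^[l]) x0).inverse (X (γ^[l] x0))

lemma diff_curve {γ X : En n → En n} (hγ : Differentiable ℂ γ) (hX : Differentiable ℂ X)
    (x0 : En n) (N : ℕ) : Differentiable ℂ (fun t : ℂ => (fun z => γ (z + t • X z))^[N] x0) := by
  induction N with
  | zero => simp
  | succ N ih =>
    simp only [iterate_succ_apply']
    fun_prop

lemma deriv_curve {γ X : En n → En n} (hγ : Differentiable ℂ γ)
    (hd : ∀ z, (fderiv ℂ γ z).det = 1) (hX : Differentiable ℂ X)
    (x0 : En n) (N : ℕ) : HasDerivAt (fun t : ℂ => (fun z => γ (z + t • X z))^[N] x0)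
      (fderiv ℂ (γ^[N]) x0 (sN γ x0 X N)) 0 := by
  induction N with
  | zero => simpa [sN] using hasDerivAt_const _ _
  | succ N ih =>
    simp only [iterate_succ_apply']
    have e0 : (fun z => γ (z + (0:ℂ) • X z))^[N] x0 = γ^[N] x0 := by simp
    set p := (fun t : ℂ => (fun z => γ (z + t • X z))^[N] x0) with hp
    have hp0 : p 0 = γ^[N] x0 := e0
    have h1 : HasDerivAt (fun t : ℂ => X (p t)) (fderiv ℂ X (p 0) (fderiv ℂ (γ^[N]) x0 (sN γ x0 X N))) 0 :=
      (hX (p 0)).hasFDerivAt.comp_hasDerivAt 0 ih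
    have h2 := ih.add ((hasDerivAt_id (0:ℂ)).smul h1)
    have h3 : HasFDerivAt γ (fderiv ℂ γ ((p + (id : ℂ → ℂ) • fun t => X (p t)) 0)) ((p + (id : ℂ → ℂ) • fun t => X (p t)) 0) := (hγ _).hasFDerivAt
    have h4 := h3.comp_hasDerivAt 0 h2
    have e5 : (p + (id : ℂ → ℂ) • fun t => X (p t)) 0 = γ^[N] x0 := by simp [hp0]
    have e6 : fderiv ℂ (γ^[N+1]) x0 (sN γ x0 X (N+1)) = fderiv ℂ γ (γ^[N] x0) 
       (fderiv ℂ (γ^[N]) x0 (sN γ x0 X N) + ((id (0:ℂ)) • fderiv ℂ X (p 0) (fderiv ℂ (γ^[N]) x0 (sN γ x0 X N)) + (1:ℂ) • X (p 0))) := by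
      rw [add_comm N 1, fderiv_iter_add hγ, add_comm 1 N, sN, Finset.sum_range_succ, ← sN,
        ContinuousLinearMap.comp_apply, iterate_one, map_add (fderiv ℂ (γ^[N]) x0),
        (inv_props _ (det_iter hγ hd N x0)).2, hp0]
      simp
    rw [e6, ← e5]
    exact h4

lemma sN_shear_bdd {γ : En n → En n} (hγ : Differentiable ℂ γ)
    (hd : ∀ z, (fderiv ℂ γ z).det = 1) {X : En n → En n} (hX : Differentiable ℂ X) {x0 : En n}
    {R r K : ℝ} (hr : 0 < r) (hb : ∀ t : ℂ, ‖t‖ < r → ∀ j, ‖(fun z => γ (z + t • X z))^[j] x0‖ ≤ R)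
    (hK : ∀ l v, ‖v‖ ≤ K * ‖fderiv ℂ (γ^[l]) x0 v‖) (hK0 : 0 ≤ K) (N : ℕ) :
    ‖sN γ x0 X N‖ ≤ K * (2 * R / r) := by
  refine (hK N _).trans ?_
  gcongr
  have h := deriv_curve hγ hd hX x0 N
  rw [← h.deriv, norm_deriv_eq_norm_fderiv]
  apply cauchy_fderiv (diff_curve hγ hX x0 N) hr
  intro t ht
  exact hb t (by simpa using ht) N

lemma diff_expShear (a : En n →L[ℂ] ℂ) (u : En n) : Differentiable ℂ (expShear a u) := by
  unfold expShear; fun_prop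

lemma sN_add (γ : En n → En n) (x0 : En n) (X Y : En n → En n) (N : ℕ) :
    sN γ x0 (X + Y) N = sN γ x0 X N + sN γ x0 Y N := by
  simp [sN, Finset.sum_add_distrib]

lemma sN_smul (γ : En n → En n) (x0 : En n) (c : ℂ) (X : En n → En n) (N : ℕ) :
    sN γ x0 (c • X) N = c • sN γ x0 X N := by
  simp [sN, Finset.smul_sum]

lemma sN_growth (hn : 2 ≤ n) {γ : En n → En n} (hγ : Differentiable ℂ γ)
    (hd : ∀ z, (fderiv ℂ γ z).det = 1) {x0 : En n} {R K : ℝ}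
    (hb : ∀ (a : En n →L[ℂ] ℂ) (u : En n), a u = 0 → ∃ r > 0, ∀ t : ℂ, ‖t‖ < r → ∀ j,
      ‖(fun z => γ (z + t • expShear a u z))^[j] x0‖ ≤ R)
    (hb0 : ∀ j, ‖γ^[j] x0‖ ≤ R)
    (hK : ∀ l v, ‖v‖ ≤ K * ‖fderiv ℂ (γ^[l]) x0 v‖) (hK0 : 0 < K)
    {X : En n → En n} (hX : Differentiable ℂ X) (hdiv : ∀ z, dvg X z = 0) {η : ℝ} (hη : 0 < η) :
    ∃ C, ∀ N : ℕ, ‖sN γ x0 X N‖ ≤ C + N * η := by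
  have hspan : ∀ P ∈ shearSpan (En n), ∃ C, ∀ N, ‖sN γ x0 P N‖ ≤ C := by
    intro P hP
    induction hP using Submodule.span_induction with
    | mem X hX =>
      obtain ⟨a, u, hau, rfl⟩ := hX
      obtain ⟨r, hr, h⟩ := hb a u hau
      exact ⟨_, fun N => sN_shear_bdd hγ hd (diff_expShear a u) hr h hK hK0.le N⟩
    | zero => exact ⟨0, fun N => by simp [sN]⟩
    | add X Y _ _ hX hY =>
      obtain ⟨C, hC⟩ := hX
      obtain ⟨C', hC'⟩ := hY
      exact ⟨C + C', fun N => by rw [sN_add]; exact norm_add_le_of_le (hC N) (hC' N)⟩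
    | smul c X _ hX =>
      obtain ⟨C, hC⟩ := hX
      exact ⟨‖c‖ * C, fun N => by rw [sN_smul, norm_smul]; gcongr; exact hC N⟩
  have : Nonempty (Fin n) := ⟨⟨0, by omega⟩⟩
  obtain ⟨P, hP, hPX⟩ := divfree_approx X hX hdiv (R := max R 1) (by positivity) (η := η / K) (by positivity)
  obtain ⟨C, hC⟩ := hspan P hP
  refine ⟨C, fun N => ?_⟩
  have e : sN γ x0 X N = sN γ x0 P N + sN γ x0 (X - P) N := by rw [← sN_add]; simp
  rw [e]
  refine norm_add_le_of_le (hC N) ?_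
  unfold sN
  refine (norm_sum_le _ _).trans ?_
  refine (Finset.sum_le_card_nsmul _ _ η ?_).trans (by simp)
  intro l _
  refine (hK l _).trans ?_
  rw [(inv_props _ (det_iter hγ hd l x0)).2]
  have := hPX (γ^[l] x0) ((hb0 l).trans (le_max_left _ _))
  calc K * ‖(X - P) (γ^[l] x0)‖ ≤ K * (η / K) := by gcongr; exact this
    _ = η := by field_simp
end PF

set_option linter.unusedSectionVars false
section PG
variable {n : ℕ}

lemma close_pair {α : Type} [PseudoMetricSpace α] [ProperSpace α] (a : ℕ → α) {x : α} {R δ : ℝ}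
    (ha : ∀ l, a l ∈ closedBall x R) (hδ : 0 < δ) : ∃ i i', i < i' ∧ dist (a i') (a i) < δ := by
  obtain ⟨y, _, φ, hφ, hy⟩ := (isCompact_closedBall x R).tendsto_subseq ha
  obtain ⟨N, hN⟩ := Metric.cauchySeq_iff.1 hy.cauchySeq δ hδ
  exact ⟨φ N, φ (N+1), hφ (Nat.lt_succ_self N), hN (N+1) (by omega) N le_rfl⟩

lemma core_M1 (hn : 2 ≤ n) {γ : En n → En n} (hγ : Differentiable ℂ γ)
    (hd : ∀ z, (fderiv ℂ γ z).det = 1) {U : Set (En n)} (hU : IsOpen U) {x0 : En n} {R : ℝ}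
    (hx0 : x0 ∈ U)
    (hb : ∀ (a : En n →L[ℂ] ℂ) (u : En n), a u = 0 → ∃ r > 0, ∀ t : ℂ, ‖t‖ < r → ∀ j,
      ‖(fun z => γ (z + t • expShear a u z))^[j] x0‖ ≤ R)
    (hb0 : ∀ j, ∀ x ∈ U, ‖γ^[j] x‖ ≤ R) : ∃ i i', i < i' ∧ γ^[i] x0 = γ^[i'] x0 := by
  by_contra! hne
  obtain ⟨ρ, hρ, K, hK1, hρU, hcore⟩ := core_bounds hγ hd hU hb0 hx0
  have hK0 : 0 < K := by linarith
  have hx00 : x0 ∈ ball x0 ρ := mem_ball_self hρ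
  obtain ⟨τ, hτ, hPsi⟩ : ∃ τ > 0, ∀ A : En n →L[ℂ] En n, ‖A - ContinuousLinearMap.id ℂ (En n)‖ < τ →
      ‖Psi A - ContinuousLinearMap.id ℂ (En n)‖ < 1 / (8 * K^2) := by
    have := Metric.continuous_iff.1 (Psi_cont (n := n)) (ContinuousLinearMap.id ℂ (En n)) (1 / (8 * K^2)) (by positivity)
    simpa only [dist_eq_norm, Psi_id] using this
  obtain ⟨r, hr0, hr1, hr2, hr3, hr4⟩ : ∃ r > 0, r ≤ 1 ∧ r < ρ ∧ K * r ≤ 1 / (4 * K) ∧ 3 * K^4 * r < τ := by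
    refine ⟨min (min 1 (ρ/2)) (min (1/(4*K^2)) (τ/(6*K^4))), by positivity, ?_, ?_, ?_, ?_⟩
    · exact (min_le_left _ _).trans (min_le_left _ _)
    · exact ((min_le_left _ _).trans (min_le_right _ _)).trans_lt (by linarith)
    · calc _ ≤ K * (1/(4*K^2)) := by gcongr; exact (min_le_right _ _).trans (min_le_left _ _)
        _ = _ := by field_simp
    · calc _ ≤ 3 * K^4 * (τ/(6*K^4)) := by gcongr; exact (min_le_right _ _).trans (min_le_right _ _)
        _ = τ/2 := by field_simp; norm_num
        _ < τ := by linarith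
  have hprop : ProperSpace (En n →L[ℂ] En n) := FiniteDimensional.proper ℂ _
  obtain ⟨i, i', hii, hclose⟩ := close_pair (fun l => ((γ^[l] x0, fderiv ℂ (γ^[l]) x0) : En n × (En n →L[ℂ] En n)))
    (x := 0) (R := max R K) (δ := r / (2 * K)) (by
      intro l
      rw [mem_closedBall_zero_iff, Prod.norm_def]
      exact max_le_max (hb0 l x0 hx0) (hcore l x0 hx00).1) (by positivity)
  rw [Prod.dist_eq, max_lt_iff, dist_eq_norm, dist_eq_norm] at hclose
  obtain ⟨hc1, hc2⟩ := hclose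
  simp only at hc1 hc2
  obtain ⟨x', hx'r, hx'⟩ := quant_surj (differentiable_iter hγ i) hK0 (hcore i x0 hx00).2.1 hr0.le (x0 := x0)
    (by
      intro x hx
      have hxr : ‖x - x0‖ ≤ r := by rwa [mem_closedBall, dist_eq_norm] at hx
      have hxρ : x ∈ ball x0 ρ := by rw [mem_ball, dist_eq_norm]; linarith
      refine ((hcore i x0 hx00).2.2 x hxρ).1.trans ?_
      calc K * ‖x - x0‖ ≤ K * r := by gcongr
        _ ≤ 1 / (4 * K) := hr3
        _ ≤ 1 / (2 * K) := by gcongr; norm_num) hc1.le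
  have hx'ρ : x' ∈ ball x0 ρ := by rw [mem_ball, dist_eq_norm]; linarith
  set e := x' - x0 with he
  have he0 : e ≠ 0 := by
    intro h
    rw [he, sub_eq_zero] at h
    rw [h] at hx'
    exact hne i i' hii hx'
  have hepos : 0 < ‖e‖ := norm_pos_iff.2 he0
  set j := i' - i with hj
  obtain ⟨hXd, hXdiv⟩ := piola (γ^[j]) (differentiable_iter hγ j) (det_iter hγ hd j)
  obtain ⟨C, hC⟩ := sN_growth hn hγ hd hb (fun j => hb0 j x0 hx0) (fun l v => (hcore l x0 hx00).2.1 v) hK0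
    hXd hXdiv (η := ‖e‖ / 4) (by positivity)
  have key : ∀ l ≥ i, ‖(fderiv ℂ (γ^[l]) x0).inverse (piolaX (γ^[j]) (γ^[l] x0)) - e‖ ≤ ‖e‖ / 2 := by
    intro l hl
    have hl1 := hcore l x0 hx00
    have hl2 := hl1.2.2 x' hx'ρ
    have hG : γ^[j] (γ^[l] x0) = γ^[l] x' := by
      rw [← iterate_add_apply, show j + l = (l - i) + i' by omega, iterate_add_apply, ← hx',
        ← iterate_add_apply, show l - i + i = l by omega]
    have inv := inv_props _ (det_iter hγ hd l x0)
    have hB : ‖fderiv ℂ (γ^[j]) (γ^[l] x0) - ContinuousLinearMap.id ℂ (En n)‖ < τ := by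
      refine lt_of_le_of_lt ?_ hr4
      refine ContinuousLinearMap.opNorm_le_bound _ (by positivity) fun w => ?_
      obtain ⟨v, rfl⟩ : ∃ v, fderiv ℂ (γ^[l]) x0 v = w := ⟨_, inv.2 w⟩
      have e1 : fderiv ℂ (γ^[j]) (γ^[l] x0) (fderiv ℂ (γ^[l]) x0 v) =
          fderiv ℂ (γ^[l-i]) (γ^[i'] x0) (fderiv ℂ (γ^[i']) x0 v) := by
        rw [← ContinuousLinearMap.comp_apply, ← ContinuousLinearMap.comp_apply, ← fderiv_iter_add hγ, ← fderiv_iter_add hγ,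
          show j + l = (l - i) + i' by omega]
      have e2 : ∀ v, fderiv ℂ (γ^[l]) x' v = fderiv ℂ (γ^[l-i]) (γ^[i'] x0) (fderiv ℂ (γ^[i]) x' v) := by
        intro v
        rw [← hx', ← ContinuousLinearMap.comp_apply, ← fderiv_iter_add hγ, show l - i + i = l by omega]
      have e3 : ∀ w, ‖fderiv ℂ (γ^[l-i]) (γ^[i'] x0) w‖ ≤ K^2 * ‖w‖ := by
        intro w
        obtain ⟨w', rfl⟩ : ∃ v, fderiv ℂ (γ^[i]) x' v = w := ⟨_, (inv_props _ (det_iter hγ hd i x')).2 w⟩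
        rw [← e2]
        calc _ ≤ ‖fderiv ℂ (γ^[l]) x'‖ * ‖w'‖ := ContinuousLinearMap.le_opNorm _ _
          _ ≤ K * (K * ‖fderiv ℂ (γ^[i]) x' w'‖) := by
            gcongr
            · exact (hcore l x' hx'ρ).1
            · exact (hcore i x' hx'ρ).2.1 _
          _ = _ := by ring
      have e4 : ‖fderiv ℂ (γ^[i']) x0 v - fderiv ℂ (γ^[i]) x' v‖ ≤ (r + K * r) * ‖v‖ := by
        rw [← _root_.sub_apply]
        refine (ContinuousLinearMap.le_opNorm _ _).trans ?_
        gcongr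
        have : fderiv ℂ (γ^[i']) x0 - fderiv ℂ (γ^[i]) x' = (fderiv ℂ (γ^[i']) x0 - fderiv ℂ (γ^[i]) x0) + -(fderiv ℂ (γ^[i]) x' - fderiv ℂ (γ^[i]) x0) := by abel
        rw [this]
        refine norm_add_le_of_le ?_ ?_
        · refine hc2.le.trans ?_
          rw [div_le_iff₀ (by positivity)]
          nlinarith
        · rw [norm_neg]
          refine ((hcore i x0 hx00).2.2 x' hx'ρ).1.trans ?_
          gcongr
      have e5 : ‖fderiv ℂ (γ^[l]) x' v - fderiv ℂ (γ^[l]) x0 v‖ ≤ K * r * ‖v‖ := by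
        rw [← _root_.sub_apply]
        refine (ContinuousLinearMap.le_opNorm _ _).trans ?_
        gcongr
        refine hl2.1.trans ?_
        gcongr
      have e6 : (fderiv ℂ (γ^[j]) (γ^[l] x0) - ContinuousLinearMap.id ℂ (En n)) (fderiv ℂ (γ^[l]) x0 v) =
        fderiv ℂ (γ^[l-i]) (γ^[i'] x0) (fderiv ℂ (γ^[i']) x0 v - fderiv ℂ (γ^[i]) x' v) + (fderiv ℂ (γ^[l]) x' v - fderiv ℂ (γ^[l]) x0 v) := by
        rw [_root_.sub_apply, e1, map_sub, ← e2]; simp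
      rw [e6]
      calc _ ≤ K^2 * ((r + K * r) * ‖v‖) + K * r * ‖v‖ := by
            refine norm_add_le_of_le ((e3 _).trans ?_) e5
            gcongr
        _ = (K^2 * r + K^3 * r + K * r) * ‖v‖ := by ring
        _ ≤ (K^3 * r + K^3 * r + K^3 * r) * (K * ‖fderiv ℂ (γ^[l]) x0 v‖) := by
            gcongr
            · norm_num
            · exact le_self_pow₀ hK1 (by norm_num)
            · exact hl1.2.1 v
        _ = _ := by ring
    have hP := hPsi _ hB
    have f1 : ‖γ^[l] x' - γ^[l] x0‖ ≤ 2 * K * ‖e‖ := by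
      have : γ^[l] x' - γ^[l] x0 = (γ^[l] x' - γ^[l] x0 - fderiv ℂ (γ^[l]) x0 e) + fderiv ℂ (γ^[l]) x0 e := by abel
      rw [this]
      calc _ ≤ K * ‖e‖^2 + K * ‖e‖ := norm_add_le_of_le hl2.2 ((ContinuousLinearMap.le_opNorm _ _).trans (by gcongr; exact hl1.1))
        _ ≤ K * ‖e‖ + K * ‖e‖ := by
          gcongr
          nlinarith
        _ = _ := by ring
    refine (hl1.2.1 _).trans ?_
    rw [map_sub, inv.2]
    have f2 : piolaX (γ^[j]) (γ^[l] x0) - fderiv ℂ (γ^[l]) x0 e = 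
      (Psi (fderiv ℂ (γ^[j]) (γ^[l] x0)) - ContinuousLinearMap.id ℂ (En n)) (γ^[l] x' - γ^[l] x0) + (γ^[l] x' - γ^[l] x0 - fderiv ℂ (γ^[l]) x0 e) := by
      rw [piolaX, hG]; simp
    rw [f2]
    calc _ ≤ K * (1 / (8 * K^2) * (2 * K * ‖e‖) + (K * r) * ‖e‖) := by
          gcongr
          refine norm_add_le_of_le ((ContinuousLinearMap.le_opNorm _ _).trans ?_) (hl2.2.trans ?_)
          · gcongr
          · rw [pow_two, ← mul_assoc]; gcongr
      _ ≤ K * (1 / (8 * K^2) * (2 * K * ‖e‖) + (1 / (4 * K)) * ‖e‖) := by gcongr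
      _ = ‖e‖ / 2 := by field_simp; norm_num
  have ind : ∀ m : ℕ, ‖sN γ x0 (piolaX (γ^[j])) (i + m) - sN γ x0 (piolaX (γ^[j])) i - (m:ℂ) • e‖ ≤ m * (‖e‖ / 2) := by
    intro m
    induction m with
    | zero => simp
    | succ m ih =>
      rw [← add_assoc, sN, Finset.sum_range_succ, ← sN]
      have := norm_add_le_of_le ih (key (i+m) (by omega))
      refine le_trans (le_of_eq ?_) (this.trans (le_of_eq ?_))
      · congr 1
        push_cast
        rw [add_smul, one_smul]
        abel
      · push_cast; ring
  obtain ⟨m, hm⟩ := exists_nat_gt ((C + i * (‖e‖ / 4) + ‖sN γ x0 (piolaX (γ^[j])) i‖) / (‖e‖ / 4))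
  rw [div_lt_iff₀ (by positivity)] at hm
  have h1 := ind m
  have h2 := hC (i + m)
  have h3 : (m:ℝ) * ‖e‖ = ‖(m:ℂ) • e‖ := by rw [norm_smul]; simp
  have h4 : ‖(m:ℂ) • e‖ ≤ ‖sN γ x0 (piolaX (γ^[j])) (i + m) - sN γ x0 (piolaX (γ^[j])) i - (m:ℂ) • e‖ + (‖sN γ x0 (piolaX (γ^[j])) (i + m)‖ + ‖sN γ x0 (piolaX (γ^[j])) i‖) := by
    have : (m:ℂ) • e = -(sN γ x0 (piolaX (γ^[j])) (i + m) - sN γ x0 (piolaX (γ^[j])) i - (m:ℂ) • e) + (sN γ x0 (piolaX (γ^[j])) (i + m) - sN γ x0 (piolaX (γ^[j])) i) := by abel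
    conv_lhs => rw [this]
    refine norm_add_le_of_le (by rw [norm_neg]) (norm_sub_le _ _)
  push_cast at h2
  nlinarith
end PG

set_option linter.unusedSectionVars false
section PH
variable {n : ℕ}

lemma hasFDerivAt_ridge {h : ℂ → ℂ} (hh : Differentiable ℂ h) (a : En n →L[ℂ] ℂ) (u z : En n) :
    HasFDerivAt (fun z => h (a z) • u) (deriv h (a z) • a.smulRight u) z := by
  have h1 : HasFDerivAt (fun z => h (a z)) (deriv h (a z) • a) z :=
    ((hh (a z)).hasDerivAt).comp_hasFDerivAt z a.hasFDerivAt
  have h2 := h1.smul_const u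
  have e : (deriv h (a z) • a).smulRight u = deriv h (a z) • a.smulRight u := by
    ext1 v; simp [mul_smul]
  rwa [e] at h2

lemma dvg_ridge {h : ℂ → ℂ} (hh : Differentiable ℂ h) (a : En n →L[ℂ] ℂ) (u : En n) (hau : a u = 0)
    (z : En n) : dvg (fun z => h (a z) • u) z = 0 := by
  rw [dvg, (hasFDerivAt_ridge hh a u z).fderiv]
  have : ((deriv h (a z) • a.smulRight u : En n →L[ℂ] En n) : En n →ₗ[ℂ] En n) =
    deriv h (a z) • (a : En n →ₗ[ℂ] ℂ).smulRight u := by ext1 v; simp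
  rw [this, map_smul, LinearMap.trace_smulRight]
  simp [hau]

lemma exists_ker (hn : 2 ≤ n) (a : En n →L[ℂ] ℂ) : ∃ u, u ≠ 0 ∧ a u = 0 := by
  have : LinearMap.ker (a : En n →ₗ[ℂ] ℂ) ≠ ⊥ := by
    apply LinearMap.ker_ne_bot_of_finrank_lt
    simp; omega
  obtain ⟨u, hu, hu0⟩ := Submodule.exists_mem_ne_zero_of_ne_bot this
  exact ⟨u, hu0, hu⟩

lemma exists_interp (s : Finset ℂ) (w : ℂ) (hw : w ∉ s) : ∃ h : ℂ → ℂ, Differentiable ℂ h ∧ h w = 1 ∧ ∀ v ∈ s, h v = 0 := by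
  refine ⟨fun ζ => ∏ v ∈ s, (ζ - v) / (w - v), ?_, ?_, ?_⟩
  · fun_prop
  · apply Finset.prod_eq_one
    intro v hv
    apply div_self
    rw [sub_ne_zero]
    rintro rfl
    exact hw hv
  · intro v hv
    exact Finset.prod_eq_zero hv (by simp)

lemma exists_sep_functional (s : Finset (En n)) (x : En n) (hx : x ∉ s) :
    ∃ a : En n →L[ℂ] ℂ, ∀ y ∈ s, a y ≠ a x := by
  obtain ⟨f, hf⟩ := Module.exists_dual_forall_apply_ne_zero (K := ℂ) (fun y : s => (y : En n) - x) (by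
    rintro ⟨y, hy⟩
    rw [Ne, sub_eq_zero]
    rintro rfl
    exact hx hy)
  refine ⟨LinearMap.toContinuousLinearMap f, fun y hy h => hf ⟨y, hy⟩ ?_⟩
  rw [map_sub, sub_eq_zero]
  exact h

theorem core (hn : 2 ≤ n) {γ : En n → En n} (hγ : Differentiable ℂ γ) (hinj : Injective γ)
    (hd : ∀ z, (fderiv ℂ γ z).det = 1) {U : Set (En n)} (hU : IsOpen U) (hUne : U.Nonempty) {R : ℝ}
    (hb : ∀ (a : En n →L[ℂ] ℂ) (u : En n), a u = 0 → ∃ r > 0, ∀ t : ℂ, ‖t‖ < r → ∀ j, ∀ x ∈ U,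
      ‖(fun z => γ (z + t • expShear a u z))^[j] x‖ ≤ R) : False := by
  have hb0 : ∀ j, ∀ x ∈ U, ‖γ^[j] x‖ ≤ R := by
    obtain ⟨r, hr, h⟩ := hb 0 0 (by simp)
    intro j x hx
    simpa using h 0 (by simpa using hr) j x hx
  have hb' : ∀ x ∈ U, ∀ (a : En n →L[ℂ] ℂ) (u : En n), a u = 0 → ∃ r > 0, ∀ t : ℂ, ‖t‖ < r → ∀ j,
      ‖(fun z => γ (z + t • expShear a u z))^[j] x‖ ≤ R := by
    intro x hx a u hau
    obtain ⟨r, hr, h⟩ := hb a u hau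
    exact ⟨r, hr, fun t ht j => h t ht j x hx⟩
  have hper : ∀ x ∈ U, ∃ k : ℕ, γ^[k+1] x = x := by
    intro x hx
    obtain ⟨i, i', hii, h⟩ := core_M1 hn hγ hd hU hx (hb' x hx) hb0
    refine ⟨i' - i - 1, ?_⟩
    apply hinj.iterate i
    rw [← iterate_add_apply, h]
    congr 2
    omega
  have hcont : ∀ k, Continuous (γ^[k]) := fun k => hγ.continuous.iterate k
  obtain ⟨V, hVo, ⟨v0, hv0⟩, hVU, j, hj0, hj⟩ : ∃ V : Set (En n), IsOpen V ∧ V.Nonempty ∧ V ⊆ U ∧ ∃ j, 0 < j ∧ ∀ x ∈ V, γ^[j] x = x := by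
    have hD := dense_iUnion_interior_of_closed (f := fun k : ℕ => {x | γ^[k+1] x = x} ∪ Uᶜ)
      (fun k => (isClosed_eq (hcont _) continuous_id).union hU.isClosed_compl) (by
        rw [eq_univ_iff_forall]
        intro x
        rw [mem_iUnion]
        by_cases hx : x ∈ U
        · obtain ⟨k, hk⟩ := hper x hx
          exact ⟨k, Or.inl hk⟩
        · exact ⟨0, Or.inr hx⟩)
    obtain ⟨x, hxU, hx⟩ := hD.inter_open_nonempty U hU hUne
    obtain ⟨k, hk⟩ := mem_iUnion.1 hx
    refine ⟨U ∩ interior ({x | γ^[k+1] x = x} ∪ Uᶜ), hU.inter isOpen_interior, ⟨x, hxU, hk⟩, inter_subset_left, k+1, by omega, ?_⟩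
    intro y hy
    rcases interior_subset hy.2 with h | h
    · exact h
    · exact absurd hy.1 h
  obtain ⟨x, hxV, hmax⟩ : ∃ x ∈ V, ∀ y ∈ V, minimalPeriod γ y ≤ minimalPeriod γ x := by
    have hbd : BddAbove (minimalPeriod γ '' V) := by
      refine ⟨j, ?_⟩
      rintro _ ⟨y, hy, rfl⟩
      exact IsPeriodicPt.minimalPeriod_le hj0 (hj y hy)
    obtain ⟨x, hx, hxs⟩ := Nat.sSup_mem (s := minimalPeriod γ '' V) ⟨_, v0, hv0, rfl⟩ hbd
    refine ⟨x, hx, fun y hy => ?_⟩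
    rw [hxs]
    exact le_csSup hbd ⟨y, hy, rfl⟩
  set d := minimalPeriod γ x with hdd
  have hd0 : 0 < d := IsPeriodicPt.minimalPeriod_pos hj0 (hj x hxV)
  have hne : ∀ i, 0 < i → i < d → γ^[i] x ≠ x := fun i hi hid h =>
    absurd (IsPeriodicPt.minimalPeriod_le hi h) (by omega)
  have hev : ∀ᶠ y in 𝓝 x, γ^[d] y = y := by
    have h1 : ∀ᶠ y in 𝓝 x, ∀ i ∈ Finset.range d, 0 < i → γ^[i] y ≠ y := by
      rw [Filter.eventually_all_finset]
      intro i hi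
      by_cases h0 : 0 < i
      · have : IsOpen {y | γ^[i] y ≠ y} := isOpen_ne_fun (hcont i) continuous_id
        filter_upwards [this.mem_nhds (hne i h0 (Finset.mem_range.1 hi))] with y hy _ using hy
      · exact Eventually.of_forall fun y h => absurd h h0
    filter_upwards [h1, hVo.mem_nhds hxV] with y hy hyV
    have e : minimalPeriod γ y = d := by
      refine le_antisymm (hmax y hyV) ?_
      by_contra! hlt
      exact hy _ (Finset.mem_range.2 hlt) (IsPeriodicPt.minimalPeriod_pos hj0 (hj y hyV)) (iterate_minimalPeriod)
    rw [← e]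
    exact iterate_minimalPeriod
  have hmul : ∀ m, γ^[m * d] =ᶠ[𝓝 x] id := by
    intro m
    filter_upwards [hev] with y hy
    have hy' : IsPeriodicPt γ d y := hy
    exact hy'.const_mul m
  have hDm : ∀ m, fderiv ℂ (γ^[m * d]) x = ContinuousLinearMap.id ℂ (En n) := fun m => by
    rw [(hmul m).fderiv_eq, fderiv_id]
  obtain ⟨a, ha⟩ := exists_sep_functional (((Finset.range d).filter (0 < ·)).image fun i => γ^[i] x) x (by
    rw [Finset.mem_image]
    rintro ⟨i, hi, h⟩
    simp at hi
    exact hne i hi.2 hi.1 h)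
  obtain ⟨u, hu0, hau⟩ := exists_ker hn a
  obtain ⟨h, hh, h1, h2⟩ := exists_interp ((((Finset.range d).filter (0 < ·)).image fun i => γ^[i] x).image a) (a x) (by
    rw [Finset.mem_image]
    rintro ⟨y, hy, h⟩
    exact ha y hy h)
  obtain ⟨ρ, hρ, K, hK1, hρU, hcore⟩ := core_bounds hγ hd hU hb0 (hVU hxV)
  have hunorm : 0 < ‖u‖ := norm_pos_iff.2 hu0
  obtain ⟨C, hC⟩ := sN_growth hn hγ hd (hb' x (hVU hxV)) (fun j => hb0 j x (hVU hxV))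
    (fun l v => (hcore l x (mem_ball_self hρ)).2.1 v) (by linarith)
    (X := fun z => h (a z) • u) (fun z => (hasFDerivAt_ridge hh a u z).differentiableAt) (dvg_ridge hh a u hau)
    (η := ‖u‖ / (2 * d)) (by positivity)
  have hs : ∀ m : ℕ, sN γ x (fun z => h (a z) • u) (m * d) = (m:ℂ) • u := by
    intro m
    induction m with
    | zero => simp [sN]
    | succ m ih =>
      unfold sN at ih ⊢
      rw [add_mul, one_mul, Finset.sum_range_add, ih, Finset.sum_eq_single 0]
      · rw [add_zero, hDm, (hmul m).eq_of_nhds]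
        simp [h1, add_smul]
      · intro i hi hi0
        rw [add_comm, iterate_add_apply, (hmul m).eq_of_nhds, id]
        beta_reduce
        rw [h2]
        · simp
        · refine Finset.mem_image_of_mem _ (Finset.mem_image.2 ⟨i, ?_, rfl⟩)
          rw [Finset.mem_filter]
          exact ⟨hi, by omega⟩
      · intro h; simp at h; omega
  obtain ⟨m, hm⟩ := exists_nat_gt (C / (‖u‖ / 2))
  rw [div_lt_iff₀ (by positivity)] at hm
  have h3 := hC (m * d)
  rw [hs, norm_smul] at h3
  have e : ((m * d : ℕ) : ℝ) * (‖u‖ / (2 * d)) = m * (‖u‖ / 2) := by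
    have : (d:ℝ) ≠ 0 := by positivity
    push_cast; field_simp
  rw [e] at h3
  simp at h3
  linarith
end PH

set_option linter.unusedSectionVars false
section PI
variable {n : ℕ}

lemma autO_comp {f g : C(En n, En n)} (hf : f ∈ AutOmega n) (hg : g ∈ AutOmega n) :
    f.comp g ∈ AutOmega n := by
  obtain ⟨⟨hfd, f', hf'd, hfl, hfr⟩, hfv⟩ := hf
  obtain ⟨⟨hgd, g', hg'd, hgl, hgr⟩, hgv⟩ := hg
  refine ⟨⟨?_, g' ∘ f', hg'd.comp hf'd, ?_, ?_⟩, ?_⟩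
  · rw [ContinuousMap.coe_comp]; exact hfd.comp hgd
  · rw [ContinuousMap.coe_comp]; exact hfl.comp hgl
  · rw [ContinuousMap.coe_comp]; exact hfr.comp hgr
  · intro z
    rw [ContinuousMap.coe_comp, fderiv_comp z (hfd _) (hgd _), det_comp', hfv, hgv, one_mul]

lemma autO_inv {f : C(En n, En n)} (hf : f ∈ AutOmega n) : ∃ g ∈ AutOmega n, LeftInverse g f ∧ RightInverse g f := by
  obtain ⟨⟨hfd, f', hf'd, hfl, hfr⟩, hfv⟩ := hf
  refine ⟨⟨f', hf'd.continuous⟩, ⟨⟨hf'd, f, hfd, hfr, hfl⟩, ?_⟩, hfl, hfr⟩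
  intro z
  change (fderiv ℂ f' z).det = 1
  have h1 : f ∘ f' = id := hfr.comp_eq_id
  have h2 := fderiv_comp z (hfd (f' z)) (hf'd z)
  rw [h1, fderiv_id] at h2
  have h3 := congrArg ContinuousLinearMap.det h2
  rw [det_comp', hfv, one_mul] at h3
  rw [← h3]
  simp [ContinuousLinearMap.det]

/-- the shear map z + h(a z) u -/
def ridge (h : ℂ → ℂ) (hh : Differentiable ℂ h) (a : En n →L[ℂ] ℂ) (u : En n) : C(En n, En n) :=
  ⟨fun z => z + h (a z) • u, by have := hh.continuous; fun_prop⟩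

lemma fderiv_ridge (h : ℂ → ℂ) (hh : Differentiable ℂ h) (a : En n →L[ℂ] ℂ) (u z : En n) :
    fderiv ℂ (ridge h hh a u) z = ContinuousLinearMap.id ℂ (En n) + deriv h (a z) • a.smulRight u :=
  ((hasFDerivAt_id z).add (hasFDerivAt_ridge hh a u z)).fderiv

lemma ridge_mem (h : ℂ → ℂ) (hh : Differentiable ℂ h) (a : En n →L[ℂ] ℂ) (u : En n) (hau : a u = 0) :
    ridge h hh a u ∈ AutOmega n := by
  have hd : ∀ h : ℂ → ℂ, Differentiable ℂ h → Differentiable ℂ (fun z => z + h (a z) • u) := by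
    intro h hh
    fun_prop
  refine ⟨⟨hd h hh, fun z => z + (-h (a z)) • u, hd _ hh.neg, ?_, ?_⟩, ?_⟩
  · intro z
    simp [ridge, hau]
  · intro z
    simp [ridge, hau]
  · intro z
    rw [fderiv_ridge]
    have : ((ContinuousLinearMap.id ℂ (En n) + deriv h (a z) • a.smulRight u : En n →L[ℂ] En n) : En n →ₗ[ℂ] En n) =
      LinearMap.transvection (deriv h (a z) • (a : En n →ₗ[ℂ] ℂ)) u := by
      ext1 v
      simp [LinearMap.transvection.apply, mul_smul]
    rw [ContinuousLinearMap.det, this, LinearMap.transvection.det]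
    simp [hau]

def iterC (f : C(En n, En n)) : ℕ → C(En n, En n)
  | 0 => ContinuousMap.id _
  | k+1 => f.comp (iterC f k)

lemma iterC_coe (f : C(En n, En n)) (k : ℕ) : ⇑(iterC f k) = f^[k] := by
  induction k with
  | zero => rfl
  | succ k ih => rw [iterate_succ', ← ih]; rfl

lemma iterC_cont (k : ℕ) : Continuous (fun f : C(En n, En n) => iterC f k) := by
  induction k with
  | zero => exact continuous_const
  | succ k ih => exact ContinuousMap.continuous_comp'.comp (ih.prodMk continuous_id)

lemma iter_joint (k : ℕ) : Continuous (fun p : C(En n, En n) × En n => p.1^[k] p.2) := by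
  have : Continuous (fun p : C(En n, En n) × En n => iterC p.1 k p.2) :=
    ((iterC_cont k).comp continuous_fst).eval continuous_snd
  simpa only [iterC_coe] using this

lemma iter_cont (k : ℕ) (x : En n) : Continuous (fun f : C(En n, En n) => f^[k] x) :=
  (iter_joint k).comp (continuous_id.prodMk continuous_const)

lemma expT_diff (t : ℂ) : Differentiable ℂ (fun ζ : ℂ => t * Complex.exp ζ) := by fun_prop

def phiT (a : En n →L[ℂ] ℂ) (u : En n) (t : ℂ) : C(En n, En n) := ridge _ (expT_diff t) a u

lemma phiT_apply (a : En n →L[ℂ] ℂ) (u : En n) (t : ℂ) (z : En n) : phiT a u t z = z + t • expShear a u z := by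
  simp [phiT, ridge, expShear, mul_smul]

lemma phiT_cont (a : En n →L[ℂ] ℂ) (u : En n) : Continuous (phiT a u) := by
  let F : C(ℂ × En n, En n) := ⟨fun p => p.2 + (p.1 * Complex.exp (a p.2)) • u, by fun_prop⟩
  have : phiT a u = F.curry := by
    ext t z
    rfl
  rw [this]
  exact F.curry.continuous

lemma phiT_zero (a : En n →L[ℂ] ℂ) (u : En n) : phiT a u 0 = ContinuousMap.id _ := by
  ext1 z; simp [phiT_apply]

lemma phiT_inv (a : En n →L[ℂ] ℂ) (u : En n) (hau : a u = 0) (t : ℂ) (z : En n) :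
    phiT a u (-t) (phiT a u t z) = z := by
  simp [phiT_apply, expShear, hau]

lemma dense_plus (hn : 2 ≤ n) {f : C(En n, En n)} (hf : f ∈ AutOmega n) {O : Set C(En n, En n)}
    (hO : O ∈ 𝓝 f) {U : Set (En n)} (hU : IsOpen U) (hUne : U.Nonempty) (R : ℝ) :
    ∃ g ∈ AutOmega n, g ∈ O ∧ ∃ x ∈ U, ∃ j, R < ‖g^[j] x‖ := by
  by_contra! H
  refine core hn (γ := f) hf.1.1 (by obtain ⟨_, _, h, _⟩ := hf.1.2; exact h.injective) hf.2 hU hUne (R := R) ?_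
  intro a u hau
  have hc : Continuous (fun t => f.comp (phiT a u t)) := (ContinuousMap.continuous_postcomp f).comp (phiT_cont a u)
  have hO' : ∀ᶠ t in 𝓝 (0:ℂ), f.comp (phiT a u t) ∈ O := by
    apply hc.continuousAt
    simpa [phiT_zero] using hO
  obtain ⟨r, hr, h⟩ := Metric.eventually_nhds_iff.1 hO'
  refine ⟨r, hr, fun t ht j x hx => ?_⟩
  have := H (f.comp (phiT a u t)) (autO_comp hf (ridge_mem _ _ _ _ hau)) (h (by simpa using ht)) x hx j
  have e : (fun z => f (z + t • expShear a u z)) = ⇑(f.comp (phiT a u t)) := by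
    ext1 z; simp [phiT_apply]
  rw [e]; exact this

lemma dense_minus (hn : 2 ≤ n) {f : C(En n, En n)} (hf : f ∈ AutOmega n) {O : Set C(En n, En n)}
    (hO : O ∈ 𝓝 f) {U : Set (En n)} (hU : IsOpen U) (hUne : U.Nonempty) (R : ℝ) :
    ∃ g ∈ AutOmega n, g ∈ O ∧ ∃ y, R < ‖y‖ ∧ ∃ i, g^[i] y ∈ U := by
  by_contra! H
  obtain ⟨γ, hγ, hl, hr⟩ := autO_inv hf
  refine core hn (γ := γ) hγ.1.1 hr.injective hγ.2 hU hUne (R := R) ?_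
  intro a u hau
  have hc : Continuous (fun t => (phiT a u (-t)).comp f) :=
    (ContinuousMap.continuous_precomp f).comp ((phiT_cont a u).comp continuous_neg)
  have hO' : ∀ᶠ t in 𝓝 (0:ℂ), (phiT a u (-t)).comp f ∈ O := by
    apply hc.continuousAt
    simpa [phiT_zero] using hO
  obtain ⟨r, hr', h⟩ := Metric.eventually_nhds_iff.1 hO'
  refine ⟨r, hr', fun t ht j x hx => ?_⟩
  have hH := H ((phiT a u (-t)).comp f) (autO_comp (ridge_mem _ _ _ _ hau) hf) (h (by simpa using ht))
  by_contra! hlt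
  refine hH _ hlt j ?_
  have e : LeftInverse ⇑((phiT a u (-t)).comp f) (fun z => γ (z + t • expShear a u z)) := by
    intro z
    rw [ContinuousMap.comp_apply, hr, ← phiT_apply, phiT_inv a u hau]
  rw [e.iterate j]
  exact hx

lemma dense_both (hn : 2 ≤ n) {f : C(En n, En n)} (hf : f ∈ AutOmega n) {O : Set C(En n, En n)}
    (hO : IsOpen O) (hfO : f ∈ O) {U V : Set (En n)} (hU : IsOpen U) (hUne : U.Nonempty) (hV : IsOpen V) (hVne : V.Nonempty) (R : ℝ) :
    ∃ g ∈ AutOmega n, g ∈ O ∧ (∃ x ∈ U, ∃ j, R < ‖g^[j] x‖) ∧ ∃ y, R < ‖y‖ ∧ ∃ i, g^[i] y ∈ V := by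
  obtain ⟨g, hg, hgO, x, hx, j, hj⟩ := dense_plus hn hf (hO.mem_nhds hfO) hU hUne R
  have h1 : IsOpen {g : C(En n, En n) | R < ‖g^[j] x‖} := isOpen_lt continuous_const (iter_cont j x).norm
  have h2 : O ∩ {g : C(En n, En n) | R < ‖g^[j] x‖} ∈ 𝓝 g := (hO.inter h1).mem_nhds ⟨hgO, hj⟩
  obtain ⟨g', hg', hgO', h⟩ := dense_minus hn hg h2 hV hVne R
  have h3 : R < ‖g'^[j] x‖ := hgO'.2
  exact ⟨g', hg', hgO'.1, ⟨x, hx, j, h3⟩, h⟩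

lemma iter_far {g : C(En n, En n)} {x : En n} {j : ℕ} {R : ℝ} (hj : R < ‖g^[j] x‖) :
    ∃ O' : Set C(En n, En n), ∃ U' : Set (En n), IsOpen O' ∧ IsOpen U' ∧ g ∈ O' ∧ x ∈ U' ∧
      ∀ g' ∈ O', ∀ w ∈ U', R < ‖g'^[j] w‖ := by
  have h1 : Tendsto (fun p : C(En n, En n) × En n => ‖p.1^[j] p.2‖) (𝓝 (g, x)) (𝓝 ‖g^[j] x‖) :=
    (iter_joint j).norm.tendsto (g, x)
  have h2 : ∀ᶠ p : C(En n, En n) × En n in 𝓝 (g, x), R < ‖p.1^[j] p.2‖ := h1.eventually (lt_mem_nhds hj)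
  rw [nhds_prod_eq, eventually_prod_iff] at h2
  obtain ⟨pa, ha, pb, hb, hh⟩ := h2
  obtain ⟨O', hO', hO1, hO2⟩ := _root_.eventually_nhds_iff.1 ha
  obtain ⟨U', hU', hU1, hU2⟩ := _root_.eventually_nhds_iff.1 hb
  exact ⟨O', U', hO1, hU1, hO2, hU2, fun g' hg' w hw => hh (hO' _ hg') (hU' _ hw)⟩

lemma dense_arc (hn : 2 ≤ n) {f : C(En n, En n)} (hf : f ∈ AutOmega n) {O : Set C(En n, En n)}
    (hO : IsOpen O) (hfO : f ∈ O) {U : Set (En n)} (hU : IsOpen U) (hUne : U.Nonempty) (R : ℝ) :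
    ∃ g ∈ AutOmega n, g ∈ O ∧ ∃ (y : En n) (i j : ℕ), R < ‖y‖ ∧ g^[i] y ∈ U ∧ R < ‖g^[j] (g^[i] y)‖ := by
  obtain ⟨g, hg, hgO, x, hx, j, hj⟩ := dense_plus hn hf (hO.mem_nhds hfO) hU hUne R
  obtain ⟨O', U', hO', hU', hgO', hxU', hsub⟩ := iter_far hj
  have h2 : O ∩ O' ∈ 𝓝 g := (hO.inter hO').mem_nhds ⟨hgO, hgO'⟩
  obtain ⟨g', hg', hgO'', y, hy, i, hi⟩ := dense_minus hn hg h2 (hU.inter hU') ⟨x, hx, hxU'⟩ R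
  exact ⟨g', hg', hgO''.1, y, i, j, hy, hi.1, hsub _ hgO''.2 _ hi.2⟩
end PI

set_option linter.unusedSectionVars false
section PJ
variable {n : ℕ}

lemma exists_h (S : Finset ℂ) {R : ℝ} (hR : 0 ≤ R) (hS : ∀ s ∈ S, ‖s‖ ≤ R) {w : ℂ} (hw : R < ‖w‖) {ε : ℝ} (hε : 0 < ε) :
    ∃ h : ℂ → ℂ, Differentiable ℂ h ∧ (∀ ζ, ‖ζ‖ ≤ R → ‖h ζ‖ ≤ ε) ∧ h w = 1 ∧ ∀ s ∈ S, h s = 0 ∧ deriv h s = 0 := by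
  obtain ⟨q, hq, hq1, hq0⟩ := exists_interp S w (fun h => absurd (hS w h) (by linarith))
  obtain ⟨M, hM⟩ := (isCompact_closedBall (0:ℂ) R).exists_bound_of_continuousOn (f := fun ζ => q ζ ^ 2) (by
    have := hq.continuous; fun_prop)
  have hw0 : 0 < ‖w‖ := by linarith
  have hw0' : w ≠ 0 := norm_pos_iff.1 hw0
  have hlt : R / ‖w‖ < 1 := (div_lt_one hw0).2 hw
  have hM0 : 0 < max M 1 := by positivity
  obtain ⟨N, hN⟩ := exists_pow_lt_of_lt_one (div_pos hε hM0) hlt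
  have hd : Differentiable ℂ (fun ζ => (ζ / w) ^ N * q ζ ^ 2) := by fun_prop
  refine ⟨_, hd, ?_, ?_, ?_⟩
  · intro ζ hζ
    rw [norm_mul, norm_pow, norm_div]
    have h1 : ‖q ζ ^ 2‖ ≤ max M 1 := (hM ζ (by simpa using hζ)).trans (le_max_left _ _)
    calc _ ≤ (R / ‖w‖) ^ N * max M 1 := by gcongr
      _ ≤ (ε / max M 1) * max M 1 := by gcongr
      _ = ε := by field_simp
  · simp [hq1, hw0']
  · intro s hs
    refine ⟨by simp [hq0 s hs], ?_⟩
    have h1 : HasDerivAt (fun ζ => (ζ / w) ^ N) (deriv (fun ζ => (ζ / w) ^ N) s) s :=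
      DifferentiableAt.hasDerivAt (by fun_prop)
    have h2 : HasDerivAt (fun ζ => q ζ ^ 2) (deriv (fun ζ => q ζ ^ 2) s) s :=
      DifferentiableAt.hasDerivAt (by fun_prop)
    have h3 := ((hq s).hasDerivAt).pow 2
    have h4 : deriv (fun ζ => q ζ ^ 2) s = 0 := by
      have := h3.deriv
      simp only [hq0 s hs] at this
      refine Eq.trans ?_ (this.trans (by simp))
      rfl
    rw [h4] at h2
    have h5 := (h1.mul h2).deriv
    refine Eq.trans ?_ (h5.trans ?_)
    · rfl
    · simp [hq0 s hs]

lemma exists_h' (S : Finset ℂ) {R : ℝ} (hR : 0 ≤ R) (hS : ∀ s ∈ S, ‖s‖ ≤ R) {w : ℂ} (hw : R < ‖w‖) {ε : ℝ} (hε : 0 < ε) :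
    ∃ h : ℂ → ℂ, Differentiable ℂ h ∧ (∀ ζ, ‖ζ‖ ≤ R → ‖h ζ‖ ≤ ε) ∧ h w = 0 ∧ deriv h w = 1 ∧ ∀ s ∈ S, h s = 0 ∧ deriv h s = 0 := by
  have hw0 : 0 < R + ‖w‖ := by linarith
  obtain ⟨h, hh, hb, h1, h0⟩ := exists_h S hR hS hw (ε := ε / (R + ‖w‖)) (by positivity)
  have hder : ∀ s, HasDerivAt (fun ζ => (ζ - w) * h ζ) (1 * h s + (s - w) * deriv h s) s := by
    intro s
    exact ((hasDerivAt_id s).sub_const w).mul (hh s).hasDerivAt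
  refine ⟨fun ζ => (ζ - w) * h ζ, fun s => (hder s).differentiableAt, ?_, by simp, ?_, ?_⟩
  · intro ζ hζ
    rw [norm_mul]
    calc _ ≤ (R + ‖w‖) * (ε / (R + ‖w‖)) := by
          gcongr
          · exact (norm_sub_le _ _).trans (by gcongr)
          · exact hb ζ hζ
      _ = ε := by field_simp
  · rw [(hder w).deriv]; simp [h1]
  · intro s hs
    rw [(hder s).deriv]; simp [h0 s hs]

def RR (R' : ℝ) (z y : En n) : Prop := ∀ R, 0 ≤ R → R < R' → ∀ P : Finset (En n), (∀ p ∈ P, ‖p‖ ≤ R) →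
  ∀ ε > 0, ∃ φ ∈ AutOmega n, (∀ w, ‖w‖ ≤ R → ‖φ w - w‖ ≤ ε) ∧ (∀ p ∈ P, φ p = p) ∧ φ z = y

lemma RR.trans {R' : ℝ} {x y z : En n} (h1 : RR R' x y) (h2 : RR R' y z) : RR R' x z := by
  intro R hR0 hR P hP ε hε
  obtain ⟨φ1, hφ1, hc1, hP1, hx⟩ := h1 R hR0 hR P hP (min (ε / 2) ((R' - R) / 2)) (lt_min (by linarith) (by linarith))
  obtain ⟨φ2, hφ2, hc2, hP2, hy⟩ := h2 ((R + R') / 2) (by linarith) (by linarith) P (fun p hp => (hP p hp).trans (by linarith)) (ε / 2) (by linarith)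
  refine ⟨φ2.comp φ1, autO_comp hφ2 hφ1, ?_, ?_, by simp [hx, hy]⟩
  · intro w hw
    have a1 := hc1 w hw
    have a2 : ‖φ1 w‖ ≤ (R + R') / 2 := by
      have : φ1 w = (φ1 w - w) + w := by abel
      rw [this]
      refine (norm_add_le _ _).trans ?_
      have := a1.trans (min_le_right _ _)
      linarith
    have a3 := hc2 _ a2
    have : (φ2.comp φ1) w - w = (φ2 (φ1 w) - φ1 w) + (φ1 w - w) := by simp
    rw [this]
    refine (norm_add_le _ _).trans ?_
    have := a1.trans (min_le_left _ _)
    linarith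
  · intro p hp
    simp [hP1 p hp, hP2 p hp]

lemma RR_step {R' : ℝ} {z y : En n} (a : En n →L[ℂ] ℂ) (ha : ‖a‖ ≤ 1) (hzy : a z = a y) (hz : R' ≤ ‖a z‖) : RR R' z y := by
  intro R hR0 hR P hP ε hε
  have hle : ∀ w, ‖w‖ ≤ R → ‖a w‖ ≤ R := fun w hw =>
    (a.le_opNorm w).trans ((mul_le_mul ha hw (norm_nonneg _) zero_le_one).trans (by simp))
  obtain ⟨h, hh, hb, h1, h0⟩ := exists_h (P.image a) hR0 (by
    intro s hs
    obtain ⟨p, hp, rfl⟩ := Finset.mem_image.1 hs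
    exact hle p (hP p hp)) (w := a z) (by linarith) (ε := ε / (‖y - z‖ + 1)) (by positivity)
  refine ⟨ridge h hh a (y - z), ridge_mem _ _ _ _ (by simp [hzy]), ?_, ?_, ?_⟩
  · intro w hw
    simp only [ridge, ContinuousMap.coe_mk, add_sub_cancel_left, norm_smul]
    calc _ ≤ (ε / (‖y - z‖ + 1)) * (‖y - z‖ + 1) := by
          gcongr
          · exact hb _ (hle w hw)
          · linarith
      _ = ε := by field_simp
  · intro p hp
    simp [ridge, (h0 _ (Finset.mem_image_of_mem a hp)).1]
  · simp [ridge, h1]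

lemma RR_inner {R' : ℝ} {z w : En n} (hR : 0 < R') (hz : R' ≤ ‖z‖) (h : inner ℂ z w = inner ℂ z z) : RR R' z w ∧ RR R' w z := by
  have hz0 : ‖z‖ ≠ 0 := by linarith
  set a : En n →L[ℂ] ℂ := ((‖z‖ : ℂ)⁻¹) • innerSL ℂ z with ha
  have h1 : ‖a‖ ≤ 1 := by
    rw [ha, norm_smul, innerSL_apply_norm]
    simp [hz0]
  have h2 : a z = a w := by simp only [ha, _root_.smul_apply, innerSL_apply_apply, h]
  have h3 : ‖a z‖ = ‖z‖ := by
    simp only [ha, _root_.smul_apply, innerSL_apply_apply, inner_self_eq_norm_sq_to_K, norm_smul]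
    simp
    field_simp
  exact ⟨RR_step a h1 h2 (by rw [h3]; exact hz), RR_step a h1 h2.symm (by rw [← h2, h3]; exact hz)⟩

lemma RR_all (hn : 2 ≤ n) {R' : ℝ} {z y : En n} (hR : 0 < R') (hz : R' ≤ ‖z‖) (hy : R' ≤ ‖y‖) : RR R' z y := by
  by_cases H : ∃ v : En n, inner ℂ z v = 0 ∧ inner ℂ y v ≠ 0
  · obtain ⟨v, hv, hyv⟩ := H
    set w := z + ((inner ℂ y y - inner ℂ y z) / inner ℂ y v) • v with hw
    have h1 : inner ℂ z w = inner ℂ z z := by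
      rw [hw, inner_add_right, inner_smul_right, hv]; simp
    have h2 : inner ℂ y w = inner ℂ y y := by
      rw [hw, inner_add_right, inner_smul_right, div_mul_cancel₀ _ hyv]; simp
    exact (RR_inner hR hz h1).1.trans (RR_inner hR hy h2).2
  · push Not at H
    obtain ⟨v0, hv0, hzv0⟩ := exists_ker hn (innerSL ℂ z)
    rw [innerSL_apply_apply] at hzv0
    have hv0' : ‖v0‖ ≠ 0 := norm_ne_zero_iff.2 hv0
    set v : En n := ((R' / ‖v0‖ : ℝ) : ℂ) • v0 with hv
    have hvn : R' ≤ ‖v‖ := by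
      rw [hv, norm_smul, Complex.norm_real, Real.norm_of_nonneg (by positivity)]
      field_simp; rfl
    have hzv : inner ℂ z v = 0 := by rw [hv, inner_smul_right, hzv0, mul_zero]
    have hyv := H v hzv
    have key : ∀ x : En n, R' ≤ ‖x‖ → inner ℂ x v = 0 → RR R' x v ∧ RR R' v x := by
      intro x hx hxv
      have hvx : inner ℂ v x = 0 := inner_eq_zero_symm.1 hxv
      have h1 := RR_inner (w := x + v) hR hx (by rw [inner_add_right, hxv, add_zero])
      have h2 := RR_inner (w := x + v) hR hvn (by rw [inner_add_right, hvx, zero_add])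
      exact ⟨h1.1.trans h2.2, h2.1.trans h1.2⟩
    exact (key z hz hzv).1.trans (key y hy hyv).2

lemma reach (hn : 2 ≤ n) {R : ℝ} (hR : 0 ≤ R) {z y : En n} (hz : R < ‖z‖) (hy : R < ‖y‖) (P : Finset (En n)) (hP : ∀ p ∈ P, ‖p‖ ≤ R)
   {ε : ℝ} (hε : 0 < ε) : ∃ φ ∈ AutOmega n, (∀ w, ‖w‖ ≤ R → ‖φ w - w‖ ≤ ε) ∧ (∀ p ∈ P, φ p = p) ∧ φ z = y := by
  have h := lt_min hz hy
  exact RR_all hn (R' := min ‖z‖ ‖y‖) (by linarith) (min_le_left _ _) (min_le_right _ _) R hR h P hP ε hε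
end PJ

set_option linter.unusedSectionVars false
section PK
variable {n : ℕ}

lemma ev_ne (α β : ℂ) (hβ : β ≠ 0) : ∀ᶠ t in 𝓝[≠] (0:ℂ), α + t * β ≠ 0 := by
  by_cases hα : α = 0
  · filter_upwards [self_mem_nhdsWithin] with t ht
    rw [hα, zero_add]
    exact mul_ne_zero ht hβ
  · have : ContinuousAt (fun t : ℂ => α + t * β) 0 := by fun_prop
    exact (this.eventually_ne (by simpa using hα)).filter_mono nhdsWithin_le_nhds

lemma exists_good_functional {y v w : En n} {R : ℝ} (hR : 0 ≤ R) (hy : R < ‖y‖) (hv : v ≠ 0) (hw : w ≠ 0) :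
    ∃ a : En n →L[ℂ] ℂ, a v ≠ 0 ∧ a w ≠ 0 ∧ ‖a‖ * R < ‖a y‖ := by
  obtain ⟨f, hf⟩ := Module.exists_dual_forall_apply_ne_zero (K := ℂ) ![v, w] (by
    intro i; fin_cases i <;> simp [hv, hw])
  set b : En n →L[ℂ] ℂ := LinearMap.toContinuousLinearMap f with hb
  have hbv : b v ≠ 0 := hf 0
  have hbw : b w ≠ 0 := hf 1
  set a0 : En n →L[ℂ] ℂ := innerSL ℂ y with ha0
  have hopen : ∀ᶠ t in 𝓝 (0:ℂ), ‖a0 + t • b‖ * R < ‖(a0 + t • b) y‖ := by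
    have h1 : ContinuousAt (fun t : ℂ => ‖a0 + t • b‖ * R) 0 := by fun_prop
    have h2 : ContinuousAt (fun t : ℂ => ‖(a0 + t • b) y‖) 0 := by
      simp only [_root_.add_apply, _root_.smul_apply]; fun_prop
    apply h1.eventually_lt h2
    have e : ‖a0 y‖ = ‖y‖ * ‖y‖ := by
      rw [ha0, innerSL_apply_apply, inner_self_eq_norm_sq_to_K]
      simp [pow_two]
    have e0 : a0 + (0:ℂ) • b = a0 := by ext1 z; simp
    rw [e0, e, ha0, innerSL_apply_norm]
    have : 0 < ‖y‖ := by linarith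
    gcongr
  obtain ⟨t, h1, h2, h3⟩ := ((ev_ne (a0 v) (b v) hbv).and ((ev_ne (a0 w) (b w) hbw).and (hopen.filter_mono nhdsWithin_le_nhds))).exists
  exact ⟨a0 + t • b, by simpa using h1, by simpa using h2, h3⟩

lemma jet_aux (hn : 2 ≤ n) (y : En n) (k : ℕ) : ∀ (A : En n →L[ℂ] En n), Injective A →
    Module.finrank ℂ (LinearMap.ker ((A - ContinuousLinearMap.id ℂ (En n) : En n →L[ℂ] En n) : En n →ₗ[ℂ] En n)) ≤ k →
    ∀ (R : ℝ), 0 ≤ R → R < ‖y‖ → ∀ P : Finset (En n), (∀ p ∈ P, ‖p‖ ≤ R) → ∀ ε > 0,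
    ∃ φ ∈ AutOmega n, (∀ w, ‖w‖ ≤ R → ‖φ w - w‖ ≤ ε) ∧
      (∀ p ∈ P, φ p = p ∧ fderiv ℂ φ p = ContinuousLinearMap.id ℂ (En n)) ∧ φ y = y ∧
      Injective (fderiv ℂ φ y ∘L A - ContinuousLinearMap.id ℂ (En n)) := by
  induction k with
  | zero =>
    intro A hA hk R hR0 hR P hP ε hε
    have hid : (ContinuousMap.id (En n)) ∈ AutOmega n := by
      have := phiT_zero (0 : En n →L[ℂ] ℂ) (0 : En n)
      rw [← this]
      exact ridge_mem _ _ _ _ (by simp)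
    have hf : ∀ p, fderiv ℂ (ContinuousMap.id (En n)) p = ContinuousLinearMap.id ℂ (En n) := by
      intro p; rw [ContinuousMap.coe_id, fderiv_id]
    refine ⟨ContinuousMap.id _, hid, by simp [hε.le], fun p _ => ⟨rfl, hf p⟩, rfl, ?_⟩
    rw [hf, ContinuousLinearMap.id_comp]
    have h0 := Submodule.finrank_eq_zero.1 (Nat.le_zero.1 hk)
    exact LinearMap.ker_eq_bot.1 h0
  | succ k ih =>
    intro A hA hk R hR0 hR P hP ε hε
    by_cases hker : LinearMap.ker ((A - ContinuousLinearMap.id ℂ (En n) : En n →L[ℂ] En n) : En n →ₗ[ℂ] En n) = ⊥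
    · exact ih A hA (by rw [hker]; simp) R hR0 hR P hP ε hε
    obtain ⟨v, hv, hv0⟩ := Submodule.exists_mem_ne_zero_of_ne_bot hker
    have hAv : A v = v := by
      have : A v - v = 0 := hv
      exact sub_eq_zero.1 this
    -- functional vanishing on the range
    have hrange : LinearMap.range ((A - ContinuousLinearMap.id ℂ (En n) : En n →L[ℂ] En n) : En n →ₗ[ℂ] En n) < ⊤ := by
      rw [lt_top_iff_ne_top]
      intro h
      exact hker (LinearMap.ker_eq_bot.2 ((LinearMap.injective_iff_surjective).2 (LinearMap.range_eq_top.1 h)))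
    obtain ⟨b0, hb0, hbr⟩ := Submodule.exists_le_ker_of_lt_top _ hrange
    set b : En n →L[ℂ] ℂ := LinearMap.toContinuousLinearMap b0 with hb
    have hbr' : ∀ w, b (A w - w) = 0 := fun w => hbr ⟨w, rfl⟩
    obtain ⟨u0, hu0⟩ : ∃ u, b u ≠ 0 := by
      by_contra! h
      exact hb0 (LinearMap.ext h)
    obtain ⟨w0, hw0, hbw0⟩ := exists_ker hn b
    obtain ⟨a, hav, haw, hay⟩ := exists_good_functional hR0 hR hv0 hw0
    set u := u0 - (a u0 / a w0) • w0 with hu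
    have hau : a u = 0 := by rw [hu, map_sub, map_smul, smul_eq_mul, div_mul_cancel₀ _ haw, sub_self]
    have hbu : b u ≠ 0 := by rw [hu, map_sub, map_smul, hbw0]; simpa using hu0
    have hle : ∀ w, ‖w‖ ≤ R → ‖a w‖ ≤ ‖a‖ * R := fun w hw => (a.le_opNorm w).trans (by gcongr)
    set R2 := (R + ‖y‖) / 2 with hR2
    have hε' : 0 < min (ε / 2) (R2 - R) := lt_min (by linarith) (by linarith)
    obtain ⟨h, hh, hbd, h0, h1, hS⟩ := exists_h' (P.image a) (R := ‖a‖ * R) (by positivity) (by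
      intro s hs
      obtain ⟨p, hp, rfl⟩ := Finset.mem_image.1 hs
      exact hle p (hP p hp)) hay (ε := min (ε / 2) (R2 - R) / (‖u‖ + 1)) (by positivity)
    set ψ := ridge h hh a u with hψ
    have hψm : ψ ∈ AutOmega n := ridge_mem _ _ _ _ hau
    set T : En n →L[ℂ] En n := ContinuousLinearMap.id ℂ (En n) + a.smulRight u with hT
    have hTy : fderiv ℂ ψ y = T := by rw [hψ, fderiv_ridge, h1, one_smul]
    have hTinj : Injective T := by
      rw [injective_iff_map_eq_zero]
      intro w hw
      have h2 : w + a w • u = 0 := hw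
      have h3 : a w = 0 := by
        have := congrArg a h2
        simpa [hau] using this
      simpa [h3] using h2
    have hTA : ∀ w, (T ∘L A) w - w = (A w - w) + a (A w) • u := by
      intro w; simp [hT]; abel
    have hsub : LinearMap.ker ((T ∘L A - ContinuousLinearMap.id ℂ (En n) : En n →L[ℂ] En n) : En n →ₗ[ℂ] En n) <
        LinearMap.ker ((A - ContinuousLinearMap.id ℂ (En n) : En n →L[ℂ] En n) : En n →ₗ[ℂ] En n) := by
      have hmem : ∀ w, w ∈ LinearMap.ker ((T ∘L A - ContinuousLinearMap.id ℂ (En n) : En n →L[ℂ] En n) : En n →ₗ[ℂ] En n) →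
          A w - w = 0 ∧ a w = 0 := by
        intro w hw
        have h2 : (T ∘L A) w - w = 0 := hw
        rw [hTA] at h2
        have h3 : a (A w) = 0 := by
          have := congrArg b h2
          rw [map_add, hbr', map_smul, smul_eq_mul, map_zero, zero_add] at this
          exact (mul_eq_zero.1 this).resolve_right hbu
        rw [h3, zero_smul, add_zero] at h2
        exact ⟨h2, by rwa [sub_eq_zero.1 h2] at h3⟩
      refine lt_of_le_of_ne (fun w hw => (hmem w hw).1) fun heq => ?_
      rw [← heq] at hv
      exact hav (hmem v hv).2
    have hfr := Submodule.finrank_lt_finrank_of_lt hsub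
    obtain ⟨φ, hφm, hφc, hφP, hφy, hφi⟩ := ih (T ∘L A) (hTinj.comp hA) (by omega) R2 (by linarith) (by linarith) P
      (fun p hp => (hP p hp).trans (by linarith)) (ε / 2) (by linarith)
    have hψy : ψ y = y := by simp [hψ, ridge, h0]
    refine ⟨φ.comp ψ, autO_comp hφm hψm, ?_, ?_, by simp [hψy, hφy], ?_⟩
    · intro w hw
      have a1 : ‖ψ w - w‖ ≤ min (ε / 2) (R2 - R) := by
        simp only [hψ, ridge, ContinuousMap.coe_mk, add_sub_cancel_left, norm_smul]
        calc _ ≤ (min (ε / 2) (R2 - R) / (‖u‖ + 1)) * (‖u‖ + 1) := by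
              gcongr
              · exact hbd _ (hle w hw)
              · linarith
          _ = _ := by field_simp
      have a2 : ‖ψ w‖ ≤ R2 := by
        have : ψ w = (ψ w - w) + w := by abel
        rw [this]
        refine (norm_add_le _ _).trans ?_
        have := a1.trans (min_le_right _ _)
        linarith
      have a3 := hφc _ a2
      have : (φ.comp ψ) w - w = (φ (ψ w) - ψ w) + (ψ w - w) := by simp
      rw [this]
      refine (norm_add_le _ _).trans ?_
      have := a1.trans (min_le_left _ _)
      linarith
    · intro p hp
      have hSp := hS _ (Finset.mem_image_of_mem a hp)
      have b1 : ψ p = p := by simp [hψ, ridge, hSp.1]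
      have b2 : fderiv ℂ ψ p = ContinuousLinearMap.id ℂ (En n) := by
        rw [hψ, fderiv_ridge, hSp.2]; ext1 z; simp
      refine ⟨by simp [b1, (hφP p hp).1], ?_⟩
      rw [ContinuousMap.coe_comp, fderiv_comp p (hφm.1.1 _) (hψm.1.1 _), b1, b2, (hφP p hp).2]
      simp
    · rw [ContinuousMap.coe_comp, fderiv_comp y (hφm.1.1 _) (hψm.1.1 _), hψy, hTy, ContinuousLinearMap.comp_assoc]
      exact hφi
end PK

set_option linter.unusedSectionVars false
section PL
variable {n : ℕ}

lemma robust {g : C(En n, En n)} (hg : Differentiable ℂ g) {m : ℕ} {y : En n} (hy : g^[m] y = y)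
    (hinj : Injective (fderiv ℂ (g^[m]) y - ContinuousLinearMap.id ℂ (En n))) {W : Set (En n)} (hW : W ∈ 𝓝 y) :
    ∀ᶠ g' : C(En n, En n) in 𝓝 g, Differentiable ℂ g' → ∃ x ∈ W, g'^[m] x = x := by
  set A := fderiv ℂ (g^[m]) y - ContinuousLinearMap.id ℂ (En n) with hA
  obtain ⟨K', hK'⟩ : ∃ K : NNReal, AntilipschitzWith K A := by
    obtain ⟨K, _, h⟩ := LinearMap.exists_antilipschitzWith (A : En n →ₗ[ℂ] En n) (LinearMap.ker_eq_bot.2 hinj)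
    exact ⟨K, h⟩
  set K : ℝ := K' + 1 with hKd
  have hK : 0 < K := by positivity
  have hAK : ∀ v, ‖v‖ ≤ K * ‖A v‖ := by
    intro v
    have h1 := hK'.le_mul_dist v 0
    rw [map_zero, dist_zero_right, dist_zero_right] at h1
    have := norm_nonneg (A v)
    rw [hKd]; linarith
  have hdi := differentiable_iter hg m
  have hc : ∀ᶠ x in 𝓝 y, ‖fderiv ℂ (g^[m]) x - fderiv ℂ (g^[m]) y‖ < 1 / (4 * K) := by
    have h1 := (continuous_fderiv_entire hdi).tendsto y
    have h2 := Metric.tendsto_nhds.1 h1 (1 / (4 * K)) (by positivity)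
    simpa only [dist_eq_norm] using h2
  obtain ⟨r, hr, hr2⟩ := Metric.nhds_basis_closedBall.mem_iff.1 (Filter.inter_mem hc hW)
  set η : ℝ := min (1 / (8 * K)) (r / (2 * K)) with hη
  have hη0 : 0 < η := by positivity
  have h3 : ∀ᶠ g' : C(En n, En n) in 𝓝 g, iterC g' m ∈ {h : C(En n, En n) | ∀ z, ‖z‖ ≤ ‖y‖ + r + 1 → ‖h z - iterC g m z‖ < η} :=
    (iterC_cont m).continuousAt.eventually (co_mem_nhds (iterC g m) (‖y‖ + r + 1) hη0)
  filter_upwards [h3] with g' h4 hg'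
  have h4' : ∀ z, ‖z‖ ≤ ‖y‖ + r + 1 → ‖g'^[m] z - g^[m] z‖ < η := by
    intro z hz
    have := h4 z hz
    rwa [iterC_coe, iterC_coe] at this
  have hdi' := differentiable_iter hg' m
  obtain ⟨x, hx1, hx2⟩ := quant_surj (G := fun z => g'^[m] z - z) (hdi'.sub differentiable_id) hK hAK hr.le (x0 := y) (y := 0) (by
    intro x hx
    have e1 : fderiv ℂ (fun z => g'^[m] z - z) x = fderiv ℂ (g'^[m]) x - ContinuousLinearMap.id ℂ (En n) :=
      ((hdi' x).hasFDerivAt.sub (hasFDerivAt_id x)).fderiv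
    have e2 : fderiv ℂ (fun z => g'^[m] z - g^[m] z) x = fderiv ℂ (g'^[m]) x - fderiv ℂ (g^[m]) x :=
      ((hdi' x).hasFDerivAt.sub (hdi x).hasFDerivAt).fderiv
    have e3 := cauchy_fderiv (f := fun z => g'^[m] z - g^[m] z) (hdi'.sub hdi) (x := x) (r := 1) (M := η) one_pos (by
      intro z hz
      apply (h4' z _).le
      rw [mem_closedBall, dist_eq_norm] at hx
      rw [mem_ball, dist_eq_norm] at hz
      have a1 : ‖z‖ ≤ ‖z - x‖ + ‖x - y‖ + ‖y‖ := by
        calc ‖z‖ = ‖(z - x) + (x - y) + y‖ := by congr 1; abel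
          _ ≤ _ := norm_add₃_le
      linarith)
    have e4 : ‖fderiv ℂ (g^[m]) x - fderiv ℂ (g^[m]) y‖ < 1 / (4 * K) := (hr2 hx).1
    rw [e2] at e3
    rw [e1, hA]
    calc ‖_‖ = ‖(fderiv ℂ (g'^[m]) x - fderiv ℂ (g^[m]) x) + (fderiv ℂ (g^[m]) x - fderiv ℂ (g^[m]) y)‖ := by congr 1; abel
      _ ≤ _ := norm_add_le _ _
      _ ≤ 2 * η / 1 + 1 / (4 * K) := by gcongr
      _ ≤ 2 * (1 / (8 * K)) / 1 + 1 / (4 * K) := by gcongr; exact min_le_left _ _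
      _ = 1 / (2 * K) := by field_simp; norm_num) (by
    have := h4' y (by linarith)
    rw [hy] at this
    rw [zero_sub, norm_neg]
    exact this.le.trans (min_le_right _ _))
  refine ⟨x, (hr2 (by rw [mem_closedBall, dist_eq_norm]; exact hx1)).2, sub_eq_zero.1 hx2⟩

lemma setup {f : C(En n, En n)} {O : Set C(En n, En n)} (hO : O ∈ 𝓝 f) (c : ℝ) :
    ∃ R, 0 ≤ R ∧ c ≤ R ∧ ∃ ε > 0, ∃ O1, IsOpen O1 ∧ f ∈ O1 ∧ ∀ f1 ∈ O1, ∀ φ1 : C(En n, En n),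
      (∀ w, ‖w‖ ≤ R → ‖φ1 w - w‖ ≤ ε) → φ1.comp f1 ∈ O ∧
      ∀ φ2 : C(En n, En n), (∀ w, ‖w‖ ≤ R → ‖φ2 w - w‖ ≤ ε) → φ2.comp (φ1.comp f1) ∈ O := by
  obtain ⟨R0, hR0, ε0, hε0, h⟩ := co_nhds hO
  obtain ⟨M, hM⟩ := (isCompact_closedBall (0:En n) R0).exists_bound_of_continuousOn f.continuous.continuousOn
  have hM0 : 0 ≤ M := (norm_nonneg _).trans (hM 0 (by simp; positivity))
  have hm := co_mem_nhds f R0 (show 0 < ε0 / 4 by positivity)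
  refine ⟨max c (M + ε0), le_max_of_le_right (by positivity), le_max_left _ _, ε0 / 4, by positivity,
    interior _, isOpen_interior, mem_interior_iff_mem_nhds.2 hm, ?_⟩
  intro f1 hf1 φ1 h1
  have h0 : ∀ z, ‖z‖ ≤ R0 → ‖f1 z - f z‖ < ε0 / 4 := interior_subset hf1
  have b0 : ∀ z, ‖z‖ ≤ R0 → ‖f1 z‖ ≤ M + ε0 / 4 := by
    intro z hz
    have a1 := h0 z hz
    have a2 := hM z (by simpa using hz)
    have a3 := norm_sub_norm_le (f1 z) (f z)
    linarith
  have b1 : ∀ z, ‖z‖ ≤ R0 → ‖φ1 (f1 z) - f1 z‖ ≤ ε0 / 4 := by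
    intro z hz
    exact h1 _ (le_max_of_le_right (by linarith [b0 z hz]))
  have b2 : ∀ z, ‖z‖ ≤ R0 → ‖φ1 (f1 z) - f z‖ < ε0 / 2 := by
    intro z hz
    have := norm_sub_le_norm_sub_add_norm_sub (φ1 (f1 z)) (f1 z) (f z)
    linarith [b1 z hz, h0 z hz]
  refine ⟨h _ fun z hz => ?_, fun φ2 h2 => h _ fun z hz => ?_⟩
  · rw [ContinuousMap.comp_apply]; linarith [b2 z hz]
  · rw [ContinuousMap.comp_apply, ContinuousMap.comp_apply]
    have a1 := norm_sub_le_norm_sub_add_norm_sub (φ2 (φ1 (f1 z))) (φ1 (f1 z)) (f z)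
    have a3 := norm_sub_norm_le (φ1 (f1 z)) (f1 z)
    have a2 := h2 (φ1 (f1 z)) (le_max_of_le_right (by linarith [b0 z hz, b1 z hz]))
    linarith [b2 z hz]

lemma iter_fix {E : Type} {f φ : E → E} {x : E} {m : ℕ} (h : ∀ l, 0 < l → l < m → φ (f^[l] x) = f^[l] x) :
    ∀ l, l < m → (φ ∘ f)^[l] x = f^[l] x := by
  intro l
  induction l with
  | zero => intro _; rfl
  | succ l ih =>
    intro hl
    rw [iterate_succ_apply', ih (by omega), comp_apply, ← iterate_succ_apply' f]
    exact h _ (by omega) hl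

lemma iter_fix_last {E : Type} {f φ : E → E} {x : E} {m : ℕ} (hm : 0 < m)
    (h : ∀ l, 0 < l → l < m → φ (f^[l] x) = f^[l] x) : (φ ∘ f)^[m] x = φ (f^[m] x) := by
  obtain ⟨k, rfl⟩ : ∃ k, m = k + 1 := ⟨m - 1, by omega⟩
  rw [iterate_succ_apply', iter_fix h k (by omega), comp_apply, ← iterate_succ_apply' f]

lemma last_out {f : En n → En n} {y : En n} {R : ℝ} (hy : R < ‖y‖) (i : ℕ) :
    ∃ i0 ≤ i, R < ‖f^[i0] y‖ ∧ ∀ l, i0 < l → l ≤ i → ‖f^[l] y‖ ≤ R := by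
  induction i with
  | zero => exact ⟨0, le_rfl, hy, by intro l h1 h2; omega⟩
  | succ i ih =>
    by_cases h : R < ‖f^[i+1] y‖
    · exact ⟨i+1, le_rfl, h, by intro l h1 h2; omega⟩
    · obtain ⟨i0, a, b, c⟩ := ih
      refine ⟨i0, by omega, b, fun l h1 h2 => ?_⟩
      rcases Nat.lt_or_ge i l with h3 | h3
      · have : l = i + 1 := by omega
        rw [this]; exact not_lt.1 h
      · exact c l h1 h3

lemma first_exit {f : En n → En n} {x : En n} {R : ℝ} {j : ℕ} (hj : R < ‖f^[j] x‖) :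
    ∃ j, R < ‖f^[j] x‖ ∧ ∀ l, l < j → ‖f^[l] x‖ ≤ R := by
  classical
  have h : ∃ j, R < ‖f^[j] x‖ := ⟨j, hj⟩
  exact ⟨Nat.find h, Nat.find_spec h, fun l hl => not_lt.1 (Nat.find_min h hl)⟩

lemma shift_last {f : En n → En n} {y : En n} {R : ℝ} (hy : R < ‖y‖) (i : ℕ) :
    ∃ (y' : En n) (i' : ℕ), R < ‖y'‖ ∧ f^[i'] y' = f^[i] y ∧ ∀ l, 0 < l → l ≤ i' → ‖f^[l] y'‖ ≤ R := by
  obtain ⟨i0, h0, h1, h2⟩ := last_out (f := f) hy i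
  refine ⟨f^[i0] y, i - i0, h1, ?_, fun l hl hl' => ?_⟩
  · rw [← iterate_add_apply]; congr 2; omega
  · rw [← iterate_add_apply]; exact h2 _ (by omega) (by omega)

lemma S1_dense (hn : 2 ≤ n) {f : C(En n, En n)} (hf : f ∈ AutOmega n) {O : Set C(En n, En n)}
    (hO : O ∈ 𝓝 f) {U V : Set (En n)} (hU : IsOpen U) (hUne : U.Nonempty) (hV : IsOpen V) (hVne : V.Nonempty) :
    ∃ g ∈ AutOmega n, g ∈ O ∧ ∃ x ∈ U, ∃ k, g^[k] x ∈ V := by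
  classical
  obtain ⟨u0, hu0⟩ := hUne
  obtain ⟨v0, hv0⟩ := hVne
  obtain ⟨R, hR0, hcR, ε, hε, O1, hO1, hfO1, H⟩ := setup hO (max ‖u0‖ ‖v0‖ + 1)
  obtain ⟨f1, hf1, hf1O, ⟨x, hx, j, hj⟩, y, hy, i, hi⟩ := dense_both hn hf hO1 hfO1
    (hU.inter (isOpen_ball (x := 0) (ε := R))) ⟨u0, hu0, by rw [mem_ball_zero_iff]; linarith [le_max_left ‖u0‖ ‖v0‖]⟩
    (hV.inter (isOpen_ball (x := 0) (ε := R))) ⟨v0, hv0, by rw [mem_ball_zero_iff]; linarith [le_max_right ‖u0‖ ‖v0‖]⟩ R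
  obtain ⟨j, hj, hjl⟩ := first_exit hj
  obtain ⟨y', i', hy', he, hil⟩ := shift_last (f := f1) hy i
  rw [← he] at hi
  have hxR := mem_ball_zero_iff.1 hx.2
  have hj0 : 0 < j := by
    rcases Nat.eq_zero_or_pos j with h | h
    · rw [h] at hj; exact absurd hj (not_lt.2 hxR.le)
    · exact h
  obtain ⟨φ, hφ, hφ1, hφ2, hφ3⟩ := reach hn hR0 hj hy'
    ((Finset.range j).image (fun l => f1^[l] x) ∪ (Finset.range i').image (fun l => f1^[l+1] y')) (by
      intro p hp
      rw [Finset.mem_union, Finset.mem_image, Finset.mem_image] at hp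
      rcases hp with ⟨l, hl, rfl⟩ | ⟨l, hl, rfl⟩
      · exact hjl l (Finset.mem_range.1 hl)
      · exact hil _ (by omega) (Finset.mem_range.1 hl)) hε
  refine ⟨φ.comp f1, autO_comp hφ hf1, (H f1 hf1O φ hφ1).1, x, hx.1, i' + j, ?_⟩
  rw [ContinuousMap.coe_comp, iterate_add_apply, iter_fix_last hj0, hφ3]
  · rw [iter_fix (m := i' + 1) _ i' (by omega)]
    · exact hi.1
    · intro l h1 h2
      apply hφ2
      rw [Finset.mem_union, Finset.mem_image, Finset.mem_image]
      exact Or.inr ⟨l - 1, by rw [Finset.mem_range]; omega, by congr 2; omega⟩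
  · intro l h1 h2
    apply hφ2
    rw [Finset.mem_union, Finset.mem_image, Finset.mem_image]
    exact Or.inl ⟨l, Finset.mem_range.2 h2, rfl⟩

lemma fderiv_iter_fix {f φ : En n → En n} (hf : Differentiable ℂ f) (hφ : Differentiable ℂ φ) {x : En n} {m : ℕ}
    (h : ∀ l, 0 < l → l < m → φ (f^[l] x) = f^[l] x ∧ fderiv ℂ φ (f^[l] x) = ContinuousLinearMap.id ℂ (En n)) :
    ∀ l, l < m → fderiv ℂ ((φ ∘ f)^[l]) x = fderiv ℂ (f^[l]) x := by
  intro l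
  induction l with
  | zero => intro _; rfl
  | succ l ih =>
    intro hl
    rw [add_comm l 1, fderiv_iter_add (hφ.comp hf), fderiv_iter_add hf, ih (by omega),
      iter_fix (fun l a b => (h l a b).1) l (by omega), iterate_one, iterate_one,
      fderiv_comp _ (hφ _) (hf _), ← iterate_succ_apply' f, (h (l+1) (by omega) hl).2,
      ContinuousLinearMap.id_comp]

lemma fderiv_iter_fix_last {f φ : En n → En n} (hf : Differentiable ℂ f) (hφ : Differentiable ℂ φ) {x : En n} {m : ℕ}
    (hm : 0 < m)
    (h : ∀ l, 0 < l → l < m → φ (f^[l] x) = f^[l] x ∧ fderiv ℂ φ (f^[l] x) = ContinuousLinearMap.id ℂ (En n)) :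
    fderiv ℂ ((φ ∘ f)^[m]) x = fderiv ℂ φ (f^[m] x) ∘L fderiv ℂ (f^[m]) x := by
  obtain ⟨l, rfl⟩ : ∃ k, m = k + 1 := ⟨m - 1, by omega⟩
  rw [add_comm l 1, fderiv_iter_add (hφ.comp hf), fderiv_iter_add hf, fderiv_iter_fix hf hφ h l (by omega),
      iter_fix (fun l a b => (h l a b).1) l (by omega), iterate_one, iterate_one,
      fderiv_comp _ (hφ _) (hf _), ← iterate_succ_apply' f, add_comm 1 l]
  rfl

lemma S2_dense (hn : 2 ≤ n) {f : C(En n, En n)} (hf : f ∈ AutOmega n) {O : Set C(En n, En n)}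
    (hO : O ∈ 𝓝 f) {U : Set (En n)} (hU : IsOpen U) (hUne : U.Nonempty) :
    ∃ g ∈ AutOmega n, g ∈ O ∧ ∀ᶠ g' : C(En n, En n) in 𝓝 g, Differentiable ℂ g' →
      ∃ x ∈ U, ∃ k, 0 < k ∧ g'^[k] x = x := by
  classical
  obtain ⟨u0, hu0⟩ := hUne
  obtain ⟨R, hR0, hcR, ε, hε, O1, hO1, hfO1, H⟩ := setup hO (‖u0‖ + 1)
  obtain ⟨f1, hf1, hf1O, y0, i0, j, hy0, hi0, hj⟩ := dense_arc hn hf hO1 hfO1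
    (hU.inter (isOpen_ball (x := 0) (ε := R))) ⟨u0, hu0, by rw [mem_ball_zero_iff]; linarith⟩ R
  obtain ⟨y, i, hy, he, hil⟩ := shift_last (f := f1) hy0 i0
  rw [← he] at hi0 hj
  obtain ⟨j, hj, hjl⟩ := first_exit hj
  have hxR := mem_ball_zero_iff.1 hi0.2
  have hj0 : 0 < j := by
    rcases Nat.eq_zero_or_pos j with h | h
    · rw [h] at hj; exact absurd hj (not_lt.2 hxR.le)
    · exact h
  have hi00 : 0 < i := by
    rcases Nat.eq_zero_or_pos i with h | h
    · rw [h] at hxR; exact absurd hy (not_lt.2 hxR.le)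
    · exact h
  set m := j + i with hm
  have hm0 : 0 < m := by omega
  rw [← iterate_add_apply, ← hm] at hj
  have hml : ∀ l, 0 < l → l < m → ‖f1^[l] y‖ ≤ R := by
    intro l h1 h2
    rcases Nat.lt_or_ge i l with h3 | h3
    · have := hjl (l - i) (by omega)
      rwa [← iterate_add_apply, Nat.sub_add_cancel h3.le] at this
    · exact hil l h1 h3
  set P : Finset (En n) := (Finset.Ioo 0 m).image (fun l => f1^[l] y) with hPd
  have hPm : ∀ l, 0 < l → l < m → f1^[l] y ∈ P := fun l h1 h2 =>
    Finset.mem_image.2 ⟨l, Finset.mem_Ioo.2 ⟨h1, h2⟩, rfl⟩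
  have hP : ∀ p ∈ P, ‖p‖ ≤ R := by
    intro p hp
    obtain ⟨l, hl, rfl⟩ := Finset.mem_image.1 hp
    exact hml l (Finset.mem_Ioo.1 hl).1 (Finset.mem_Ioo.1 hl).2
  obtain ⟨φ1, hφ1, c1, c2, c3⟩ := reach hn hR0 hj hy P hP hε
  have hg1 := autO_comp hφ1 hf1
  set g1 := φ1.comp f1 with hg1d
  have e1 : ∀ l, l < m → g1^[l] y = f1^[l] y := by
    intro l hl
    rw [hg1d, ContinuousMap.coe_comp]
    exact iter_fix (fun l h1 h2 => c2 _ (hPm l h1 h2)) l hl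
  have e2 : g1^[m] y = y := by
    rw [hg1d, ContinuousMap.coe_comp, iter_fix_last hm0 (fun l h1 h2 => c2 _ (hPm l h1 h2)), c3]
  have hAinj : Injective (fderiv ℂ (g1^[m]) y) :=
    LeftInverse.injective (inv_props _ (det_iter hg1.1.1 hg1.2 m y)).1
  obtain ⟨φ2, hφ2, d1, d2, d3, d4⟩ := jet_aux hn y _ (fderiv ℂ (g1^[m]) y) hAinj le_rfl R hR0 hy P hP ε hε
  have hfix : ∀ l, 0 < l → l < m → φ2 (g1^[l] y) = g1^[l] y ∧ fderiv ℂ φ2 (g1^[l] y) = ContinuousLinearMap.id ℂ (En n) := by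
    intro l h1 h2
    rw [e1 l h2]
    exact d2 _ (hPm l h1 h2)
  have hg := autO_comp hφ2 hg1
  refine ⟨φ2.comp g1, hg, (H f1 hf1O φ1 c1).2 φ2 d1, ?_⟩
  have k1 : (φ2.comp g1)^[m] y = y := by
    rw [ContinuousMap.coe_comp, iter_fix_last hm0 (fun l a b => (hfix l a b).1), e2, d3]
  have k2 : (φ2.comp g1)^[i] y ∈ U := by
    rw [ContinuousMap.coe_comp, iter_fix (fun l a b => (hfix l a b).1) i (by omega), e1 i (by omega)]
    exact hi0.1
  have k3 : Injective (fderiv ℂ ((φ2.comp g1)^[m]) y - ContinuousLinearMap.id ℂ (En n)) := by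
    rw [ContinuousMap.coe_comp, fderiv_iter_fix_last hg1.1.1 hφ2.1.1 hm0 hfix, e2]
    exact d4
  have h1 : Tendsto (fun p : C(En n, En n) × En n => p.1^[i] p.2) (𝓝 (φ2.comp g1, y)) (𝓝 ((φ2.comp g1)^[i] y)) :=
    (iter_joint i).tendsto (φ2.comp g1, y)
  have h2 : ∀ᶠ p : C(En n, En n) × En n in 𝓝 (φ2.comp g1, y), p.1^[i] p.2 ∈ U := h1.eventually (hU.mem_nhds k2)
  rw [nhds_prod_eq, eventually_prod_iff] at h2
  obtain ⟨pa, ha, pb, hb, hh⟩ := h2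
  filter_upwards [ha, robust hg.1.1 k1 k3 hb] with g' w1 w2 hd
  obtain ⟨x, hx, hx2⟩ := w2 hd
  refine ⟨g'^[i] x, hh w1 hx, m, hm0, ?_⟩
  rw [← iterate_add_apply, add_comm, iterate_add_apply, hx2]

end PL

/-- For n ≥ 2, chaotic automorphisms are comeagre in Aut_{ω₀}(ℂⁿ): there is a
subset of Aut_{ω₀}(ℂⁿ) containing a countable intersection of dense open subsets, all of whose
elements are chaotic. -/
theorem stmt_0 (n : ℕ) (hn : 2 ≤ n) :
    ∃ S : ℕ → Set ↥(AutOmega n),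
      (∀ k, IsOpen (S k) ∧ Dense (S k)) ∧
      (⋂ k, S k) ⊆ {f : ↥(AutOmega n) | Chaotic ⇑f.1} := by
  obtain ⟨B, hBc, hBe, hB⟩ := TopologicalSpace.exists_countable_basis (En n)
  have hBne : B.Nonempty := by
    obtain ⟨v, hv, _⟩ := hB.exists_subset_of_mem_open (mem_univ (0 : En n)) isOpen_univ
    exact ⟨v, hv⟩
  obtain ⟨b, hb⟩ := hBc.exists_eq_range hBne
  have hbo : ∀ i, IsOpen (b i) := fun i => hB.isOpen (hb ▸ mem_range_self i)
  have hbn : ∀ i, (b i).Nonempty := fun i => by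
    rw [nonempty_iff_ne_empty]; intro h; exact hBe (hb ▸ ⟨i, h⟩)
  let S1 : ℕ → ℕ → Set C(En n, En n) := fun i j => {f | ∃ x ∈ b i, ∃ k, f^[k] x ∈ b j}
  let S2 : ℕ → Set ↥(AutOmega n) := fun i => interior {f | ∃ x ∈ b i, ∃ k, 0 < k ∧ f.1^[k] x = x}
  have hS1o : ∀ i j, IsOpen (S1 i j) := by
    intro i j
    rw [isOpen_iff_mem_nhds]
    rintro f ⟨x, hx, k, hk⟩
    filter_upwards [(iter_cont k x).continuousAt.eventually ((hbo j).mem_nhds hk)] with g hg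
    exact ⟨x, hx, k, hg⟩
  have hS1d : ∀ i j, Dense (Subtype.val ⁻¹' (S1 i j) : Set ↥(AutOmega n)) := by
    intro i j
    rw [dense_iff_inter_open]
    rintro W hW ⟨f, hfW⟩
    obtain ⟨O, hO, rfl⟩ := isOpen_induced_iff.1 hW
    obtain ⟨g, hg, hgO, h⟩ := S1_dense hn f.2 (hO.mem_nhds hfW) (hbo i) (hbn i) (hbo j) (hbn j)
    exact ⟨⟨g, hg⟩, hgO, h⟩
  have hS2d : ∀ i, Dense (S2 i) := by
    intro i
    rw [dense_iff_inter_open]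
    rintro W hW ⟨f, hfW⟩
    obtain ⟨O, hO, rfl⟩ := isOpen_induced_iff.1 hW
    obtain ⟨g, hg, hgO, h⟩ := S2_dense hn f.2 (hO.mem_nhds hfW) (hbo i) (hbn i)
    refine ⟨⟨g, hg⟩, hgO, mem_interior_iff_mem_nhds.2 ?_⟩
    have hc : Tendsto (Subtype.val : ↥(AutOmega n) → C(En n, En n)) (𝓝 ⟨g, hg⟩) (𝓝 g) :=
      continuous_subtype_val.tendsto _
    filter_upwards [hc.eventually h] with g' hg'
    exact hg' g'.2.1.1
  refine ⟨fun k => Subtype.val ⁻¹' (S1 k.unpair.1 k.unpair.2) ∩ S2 k.unpair.1, fun k => ⟨?_, ?_⟩, ?_⟩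
  · exact ((hS1o _ _).preimage continuous_subtype_val).inter isOpen_interior
  · exact (hS1d _ _).inter_of_isOpen_right (hS2d _) isOpen_interior
  · intro f hf
    rw [mem_iInter] at hf
    have hf1 : ∀ i j, ∃ x ∈ b i, ∃ k, f.1^[k] x ∈ b j := by
      intro i j
      have := (hf (Nat.pair i j)).1
      rw [Nat.unpair_pair] at this
      exact this
    have hf2 : ∀ i, ∃ x ∈ b i, ∃ k, 0 < k ∧ f.1^[k] x = x := by
      intro i
      have := (hf (Nat.pair i 0)).2
      rw [Nat.unpair_pair] at this
      have h3 : f ∈ {f : ↥(AutOmega n) | ∃ x ∈ b i, ∃ k, 0 < k ∧ f.1^[k] x = x} := interior_subset this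
      exact h3
    have hdense : ∀ s : Set (En n), (∀ i, (b i ∩ s).Nonempty) → Dense s := by
      intro s hs
      rw [hB.dense_iff]
      intro o ho _
      rw [hb] at ho
      obtain ⟨i, rfl⟩ := ho
      exact hs i
    refine ⟨?_, ?_⟩
    · have ho : ∀ j, IsOpen (⋃ k : ℕ, f.1^[k] ⁻¹' (b j)) := fun j =>
        isOpen_iUnion fun k => (hbo j).preimage (f.1.continuous.iterate k)
      have hd : ∀ j, Dense (⋃ k : ℕ, f.1^[k] ⁻¹' (b j)) := by
        intro j
        apply hdense
        intro i
        obtain ⟨x, hx, k, hk⟩ := hf1 i j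
        exact ⟨x, hx, mem_iUnion.2 ⟨k, hk⟩⟩
      obtain ⟨x, hx⟩ := (dense_iInter_of_isOpen ho hd).nonempty
      refine ⟨x, hdense _ fun j => ?_⟩
      obtain ⟨k, hk⟩ := mem_iUnion.1 (mem_iInter.1 hx j)
      exact ⟨_, hk, k, rfl⟩
    · apply hdense
      intro i
      obtain ⟨x, hx, k, hk⟩ := hf2 i
      exact ⟨x, hx, k, hk⟩
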